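/- arXiv:1709.05450 — 3 statements merged into one kernel-verified Lean document; each statement's English description precedes it below -/
import Mathlib

section
/- For all n×n positive definite matrices X, Y, Z with Tr[Z] = Tr[X], all t ≥ 1, and all r > 0, Tr[X log(Z^r #_t Y^r)] ≥ Tr[X ((1-t) log X^r + t log Y^r)]. -/
open Matrix ComplexOrder

noncomputable def mlog {n : Type*} [Fintype n] [DecidableEq n] (A : Matrix n n ℂ) : Matrix n n ℂ :=
  cfc Real.log A

noncomputable def mpow {n : Type*} [Fintype n] [DecidableEq n] (A : Matrix n n ℂ) (p : ℝ) :
    Matrix n n ℂ :=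
  cfc (fun x : ℝ => x ^ p) A

noncomputable def rtr {n : Type*} [Fintype n] [DecidableEq n] (A : Matrix n n ℂ) : ℝ :=
  A.trace.re

/-- The weighted geometric mean `A #_t B = A^{1/2} (A^{-1/2} B A^{-1/2})^t A^{1/2}`,
defined for all real `t`. -/
noncomputable def gm {n : Type*} [Fintype n] [DecidableEq n] (A B : Matrix n n ℂ) (t : ℝ) :
    Matrix n n ℂ :=
  mpow A (1 / 2) * mpow (mpow A (-(1 / 2)) * B * mpow A (-(1 / 2))) t * mpow A (1 / 2)

open scoped MatrixOrder Matrix.Norms.L2Operator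

section FunctionalCalculus

variable {m n : Type*} [Fintype m] [DecidableEq m] [Fintype n] [DecidableEq n]

lemma mul_aeval_of_intertwine {A : Matrix n n ℂ} {B : Matrix m m ℂ} {L : Matrix m n ℂ}
    (h : L * A = B * L) (q : Polynomial ℝ) :
    L * Polynomial.aeval A q = Polynomial.aeval B q * L := by
  induction q using Polynomial.induction_on' with
  | add p q hp hq => simp [Matrix.mul_add, Matrix.add_mul, hp, hq]
  | monomial k a =>
    have hk : L * A ^ k = B ^ k * L := by
      induction k with
      | zero => simp
      | succ k ih => rw [pow_succ, pow_succ, ← Matrix.mul_assoc, ih, Matrix.mul_assoc, h,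
          Matrix.mul_assoc]
    simp [Polynomial.aeval_monomial, Algebra.algebraMap_eq_smul_one, hk]

lemma exists_polynomial_cfc_eq {A : Matrix n n ℂ} {B : Matrix m m ℂ} (hA : A.IsHermitian)
    (hB : B.IsHermitian) (f : ℝ → ℝ) :
    ∃ q : Polynomial ℝ, cfc f A = Polynomial.aeval A q ∧ cfc f B = Polynomial.aeval B q := by
  have hfin : (spectrum ℝ A ∪ spectrum ℝ B).Finite :=
    A.finite_real_spectrum.union B.finite_real_spectrum
  set q := Lagrange.interpolate hfin.toFinset id f with hq
  have hev : ∀ x ∈ spectrum ℝ A ∪ spectrum ℝ B, f x = q.eval x := fun x hx =>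
    (Lagrange.eval_interpolate_at_node f Function.injective_id.injOn
      (hfin.mem_toFinset.mpr hx)).symm
  refine ⟨q, ?_, ?_⟩
  · rw [← cfc_polynomial q A hA]
    exact cfc_congr fun x hx => hev x (Or.inl hx)
  · rw [← cfc_polynomial q B hB]
    exact cfc_congr fun x hx => hev x (Or.inr hx)

/-- The functional calculus respects intertwining relations. -/
lemma mul_cfc_of_intertwine {A : Matrix n n ℂ} {B : Matrix m m ℂ} (hA : A.IsHermitian)
    (hB : B.IsHermitian) {L : Matrix m n ℂ} (h : L * A = B * L) (f : ℝ → ℝ) :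
    L * cfc f A = cfc f B * L := by
  obtain ⟨q, h₁, h₂⟩ := exists_polynomial_cfc_eq hA hB f
  rw [h₁, h₂, mul_aeval_of_intertwine h]

lemma cfc_diagonal_ofReal (d : n → ℝ) (f : ℝ → ℝ) :
    cfc f (diagonal fun i => (d i : ℂ)) = diagonal fun i => (f (d i) : ℂ) := by
  have hd : (diagonal fun i => (d i : ℂ)).IsHermitian := by
    rw [Matrix.isHermitian_diagonal_iff]; intro i; simp [isSelfAdjoint_iff]
  ext i j
  have h := mul_cfc_of_intertwine (A := (diagonal fun _ : Unit => (d j : ℂ)))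
    (B := diagonal fun i => (d i : ℂ))
    (by rw [Matrix.isHermitian_diagonal_iff]; intro i; simp [isSelfAdjoint_iff]) hd
    (L := Matrix.of fun i _ => if i = j then 1 else 0) (by
      ext a b; by_cases hab : a = j <;> simp [Matrix.mul_diagonal, Matrix.diagonal_mul, hab]) f
  have h1 : (diagonal fun _ : Unit => (d j : ℂ)) = algebraMap ℝ _ (d j) := by
    ext; simp [Matrix.algebraMap_matrix_apply]
  rw [h1, cfc_algebraMap] at h
  have := congrFun (congrFun h i) ()
  simp [Matrix.mul_apply, Matrix.algebraMap_matrix_apply] at this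
  rw [← this, Matrix.diagonal_apply]
  by_cases hij : i = j <;> simp [hij]

lemma cfc_conj {W : Matrix n m ℂ} (hW : Wᴴ * W = 1) (hW' : W * Wᴴ = 1) {A : Matrix n n ℂ}
    (hA : A.IsHermitian) (f : ℝ → ℝ) : cfc f (Wᴴ * A * W) = Wᴴ * cfc f A * W := by
  have h := mul_cfc_of_intertwine hA (Matrix.isHermitian_conjTranspose_mul_mul W hA) (L := Wᴴ)
    (by rw [Matrix.mul_assoc _ W, hW', Matrix.mul_one]) f
  rw [h, Matrix.mul_assoc (cfc f _), hW, Matrix.mul_one]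

lemma cfc_mul_diagonal_mul {U : Matrix m n ℂ} (hU : Uᴴ * U = 1) (hU' : U * Uᴴ = 1) (d : n → ℝ)
    (f : ℝ → ℝ) :
    cfc f (U * diagonal (fun i => (d i : ℂ)) * Uᴴ) =
      U * diagonal (fun i => (f (d i) : ℂ)) * Uᴴ := by
  have hd : (diagonal fun i => (d i : ℂ)).IsHermitian := by
    rw [Matrix.isHermitian_diagonal_iff]; intro i; simp [isSelfAdjoint_iff]
  have := cfc_conj (W := Uᴴ) (by simpa using hU') (by simpa using hU) hd f
  simpa [cfc_diagonal_ofReal] using this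

end FunctionalCalculus

section Diagonalization

variable {n : Type*} [Fintype n] [DecidableEq n]

/-- Diagonalization of a Hermitian matrix with eigenvalues in decreasing order. -/
lemma Matrix.IsHermitian.exists_antitone_diagonalization {A : Matrix n n ℂ} (hA : A.IsHermitian)
    {m : ℕ} (hm : Fintype.card n = m) :
    ∃ (U : Matrix n (Fin m) ℂ) (d : Fin m → ℝ), Uᴴ * U = 1 ∧ U * Uᴴ = 1 ∧ Antitone d ∧
      A = U * diagonal (fun i => (d i : ℂ)) * Uᴴ := by
  subst hm
  let e : Fin (Fintype.card n) ≃ n := Fintype.equivOfCardEq (Fintype.card_fin _)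
  let V : Matrix n n ℂ := hA.eigenvectorUnitary
  have hV : Vᴴ * V = 1 := Unitary.coe_star_mul_self hA.eigenvectorUnitary
  have hV' : V * Vᴴ = 1 := Unitary.coe_mul_star_self hA.eigenvectorUnitary
  have hmul : ∀ D : Matrix n n ℂ, V.submatrix id e * D.submatrix e e * (V.submatrix id e)ᴴ =
      V * D * Vᴴ := by
    intro D
    rw [Matrix.conjTranspose_submatrix, Matrix.submatrix_mul_equiv, Matrix.submatrix_mul_equiv]
    simp
  refine ⟨V.submatrix id e, hA.eigenvalues₀, ?_, ?_, hA.eigenvalues₀_antitone, ?_⟩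
  · have : (Vᴴ).submatrix e id * V.submatrix id e = (Vᴴ * V).submatrix e e :=
      (Matrix.submatrix_mul _ _ _ _ _ Function.bijective_id).symm
    rw [Matrix.conjTranspose_submatrix, this, hV, Matrix.submatrix_one_equiv]
  · have h := hmul 1
    rwa [Matrix.mul_one, hV', Matrix.submatrix_one_equiv, Matrix.mul_one] at h
  · have h := hmul (diagonal fun i => (hA.eigenvalues i : ℂ))
    rw [Matrix.submatrix_diagonal_equiv] at h
    have he : (fun i => (hA.eigenvalues₀ i : ℂ)) = (fun i => (hA.eigenvalues i : ℂ)) ∘ e := by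
      ext i; simp [Matrix.IsHermitian.eigenvalues, e]
    rw [he, h]
    conv_lhs => rw [hA.spectral_theorem, Unitary.conjStarAlgAut_apply]
    rfl

lemma Matrix.PosDef.exists_antitone_diagonalization {A : Matrix n n ℂ} (hA : A.PosDef)
    {m : ℕ} (hm : Fintype.card n = m) :
    ∃ (U : Matrix n (Fin m) ℂ) (d : Fin m → ℝ), Uᴴ * U = 1 ∧ U * Uᴴ = 1 ∧ Antitone d ∧
      (∀ i, 0 < d i) ∧ A = U * diagonal (fun i => (d i : ℂ)) * Uᴴ := by
  obtain ⟨U, d, hU, hU', hd, h⟩ := hA.isHermitian.exists_antitone_diagonalization hm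
  refine ⟨U, d, hU, hU', hd, fun i => ?_, h⟩
  have hD : Uᴴ * A * U = diagonal (fun i => (d i : ℂ)) := by
    rw [h]
    calc _ = (Uᴴ * U) * diagonal (fun i => (d i : ℂ)) * (Uᴴ * U) := by simp only [Matrix.mul_assoc]
      _ = _ := by rw [hU, Matrix.one_mul, Matrix.mul_one]
  have hpd : (Uᴴ * A * U).PosDef := hA.conjTranspose_mul_mul_same <|
    Function.LeftInverse.injective (g := Uᴴ.mulVec) fun v => by
      rw [Matrix.mulVec_mulVec, hU, Matrix.one_mulVec]
  have := hpd.diag_pos (i := i)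
  rw [hD] at this
  simpa using this

end Diagonalization

section Compound

variable {m k : ℕ}

/-- The `k`-th compound matrix, whose entries are the `k × k` minors. -/
noncomputable def compound (k : ℕ) (A : Matrix (Fin m) (Fin m) ℂ) :
    Matrix (Fin k ↪o Fin m) (Fin k ↪o Fin m) ℂ :=
  Matrix.of fun s t => (A.submatrix s t).det

lemma compound_eq_toMatrix (A : Matrix (Fin m) (Fin m) ℂ) :
    compound k A = (LinearMap.toMatrix ((Pi.basisFun ℂ (Fin m)).exteriorPower k)
      ((Pi.basisFun ℂ (Fin m)).exteriorPower k) (exteriorPower.map k (toLin' A))).submatrix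
      Set.powersetCard.ofFinEmbEquiv Set.powersetCard.ofFinEmbEquiv := by
  ext s t
  rw [Matrix.submatrix_apply, LinearMap.toMatrix_apply, exteriorPower.basis_apply,
    exteriorPower.map_apply_ιMulti_family, exteriorPower.basis_repr_apply,
    exteriorPower.ιMulti_family, exteriorPower.ιMultiDual_apply_ιMulti, compound, Matrix.of_apply,
    ← Matrix.det_transpose]
  congr 1
  ext i j
  simp

lemma compound_mul (A B : Matrix (Fin m) (Fin m) ℂ) :
    compound k (A * B) = compound k A * compound k B := by
  simp only [compound_eq_toMatrix]
  rw [Matrix.submatrix_mul_equiv, ← LinearMap.toMatrix_comp, ← exteriorPower.map_comp,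
    Matrix.toLin'_mul]

lemma compound_conjTranspose (A : Matrix (Fin m) (Fin m) ℂ) :
    compound k Aᴴ = (compound k A)ᴴ := by
  ext s t
  simp [compound, ← Matrix.det_conjTranspose, Matrix.conjTranspose_submatrix]

lemma compound_diagonal (d : Fin m → ℂ) :
    compound k (diagonal d) = diagonal fun s => ∏ i, d (s i) := by
  ext s t
  by_cases h : s = t
  · subst h
    simp [compound, Matrix.submatrix_diagonal _ s s.injective, Matrix.det_diagonal]
  · rw [Matrix.diagonal_apply_ne _ h]
    obtain ⟨i, hi⟩ : ∃ i, s i ∉ Set.range t := by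
      by_contra! hc
      apply h
      have hsub : Set.range s ⊆ Set.range t := by rintro _ ⟨i, rfl⟩; exact hc i
      have : Set.range s = Set.range t := by
        apply Set.eq_of_subset_of_ncard_le hsub _ (Set.toFinite _)
        rw [← Set.image_univ, ← Set.image_univ, Set.ncard_image_of_injective _ s.injective,
          Set.ncard_image_of_injective _ t.injective]
      exact DFunLike.coe_injective (StrictMono.range_inj s.strictMono t.strictMono |>.mp this)
    apply Matrix.det_eq_zero_of_row_eq_zero i
    intro j
    exact Matrix.diagonal_apply_ne _ fun hij => hi ⟨j, hij.symm⟩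

lemma compound_one : compound k (1 : Matrix (Fin m) (Fin m) ℂ) = 1 := by
  rw [← Matrix.diagonal_one, compound_diagonal]; simp

lemma compound_mul_diagonal_mul (U : Matrix (Fin m) (Fin m) ℂ) (d : Fin m → ℝ) :
    compound k (U * diagonal (fun i => (d i : ℂ)) * Uᴴ) =
      compound k U * diagonal (fun s => ((∏ i, d (s i) : ℝ) : ℂ)) * (compound k U)ᴴ := by
  rw [compound_mul, compound_mul, compound_diagonal, compound_conjTranspose]
  simp

lemma conjTranspose_compound_mul_self {U : Matrix (Fin m) (Fin m) ℂ} (hU : Uᴴ * U = 1) :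
    (compound k U)ᴴ * compound k U = 1 := by
  rw [← compound_conjTranspose, ← compound_mul, hU, compound_one]

lemma compound_mul_conjTranspose_self {U : Matrix (Fin m) (Fin m) ℂ} (hU : U * Uᴴ = 1) :
    compound k U * (compound k U)ᴴ = 1 := by
  rw [← compound_conjTranspose, ← compound_mul, hU, compound_one]

lemma hasDerivAt_det_one_add_smul {ι : Type*} [Fintype ι] [DecidableEq ι] (K : Matrix ι ι ℂ) :
    HasDerivAt (fun x : ℂ => (1 + x • K).det) K.trace 0 := by
  rw [funext fun x : ℂ => Matrix.det_one_add_smul x K]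
  have h1 : HasDerivAt (fun x : ℂ => 1 + K.trace * x) K.trace 0 := by
    simpa using ((hasDerivAt_id (0 : ℂ)).const_mul K.trace).const_add 1
  have h2 := ((det (1 + (Polynomial.X : Polynomial ℂ) •
    K.map Polynomial.C)).divX.divX.hasDerivAt 0).fun_mul ((hasDerivAt_id (0 : ℂ)).fun_pow 2)
  simpa using h1.fun_add h2

/-- The derivation induced by a Hermitian matrix on the exterior power has as diagonal entries
the traces of the principal submatrices. -/
lemma compound_mul_diagonal_sum_mul_apply {U : Matrix (Fin m) (Fin m) ℂ} (hU : U * Uᴴ = 1)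
    (d : Fin m → ℂ) (s : Fin k ↪o Fin m) :
    (compound k U * diagonal (fun t : Fin k ↪o Fin m => ∑ i, d (t i)) * (compound k U)ᴴ) s s =
      ∑ i, (U * diagonal d * Uᴴ) (s i) (s i) := by
  have key : ∀ x : ℂ, (1 + x • (U * diagonal d * Uᴴ).submatrix s s).det =
      ∑ t, compound k U s t * (1 + x • diagonal (fun i => d (t i))).det *
        star (compound k U s t) := by
    intro x
    have h1 : compound k (1 + x • (U * diagonal d * Uᴴ)) =
        compound k U * compound k (diagonal (fun i => 1 + x * d i)) * (compound k U)ᴴ := by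
      rw [← compound_conjTranspose, ← compound_mul, ← compound_mul]
      congr 1
      have : (diagonal fun i => 1 + x * d i) = 1 + x • diagonal d := by
        ext i j; by_cases h : i = j <;> simp [h]
      rw [this, Matrix.mul_add, Matrix.add_mul, Matrix.mul_one, hU]
      simp
    have h2 := congrFun (congrFun h1 s) s
    rw [compound_diagonal] at h2
    have h3 : (1 + x • (U * diagonal d * Uᴴ)).submatrix s s =
        1 + x • (U * diagonal d * Uᴴ).submatrix s s := by
      ext i j
      simp [Matrix.one_apply, s.injective.eq_iff]
    rw [compound, Matrix.of_apply, h3] at h2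
    rw [h2, Matrix.mul_apply]
    refine Finset.sum_congr rfl fun t _ => ?_
    rw [Matrix.mul_diagonal, Matrix.conjTranspose_apply]
    congr 2
    have : 1 + x • diagonal (fun i => d (t i)) = diagonal fun i => 1 + x * d (t i) := by
      ext i j; by_cases h : i = j <;> simp [h]
    rw [this, Matrix.det_diagonal]
  have h1 := hasDerivAt_det_one_add_smul ((U * diagonal d * Uᴴ).submatrix s s)
  have h2 : HasDerivAt (fun x : ℂ => ∑ t, compound k U s t *
      (1 + x • diagonal (fun i => d (t i))).det * star (compound k U s t))
      (∑ t, compound k U s t * (diagonal (fun i => d (t i))).trace * star (compound k U s t)) 0 :=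
    HasDerivAt.fun_sum fun t _ =>
      ((hasDerivAt_det_one_add_smul (diagonal (fun i => d (t i)))).const_mul _).mul_const _
  have := h1.unique (by simpa only [key] using h2)
  rw [Matrix.mul_apply]
  simp only [Matrix.mul_diagonal, Matrix.conjTranspose_apply]
  simp only [Matrix.trace_diagonal] at this
  rw [← this]
  rfl

end Compound

section GeometricMean

variable {m n : Type*} [Fintype m] [DecidableEq m] [Fintype n] [DecidableEq n]

lemma mpow_eq_rpow {A : Matrix n n ℂ} (hA : A.PosDef) (p : ℝ) : mpow A p = A ^ p :=
  (CFC.rpow_eq_cfc_real hA.posSemidef.nonneg).symm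

lemma posDef_mpow {A : Matrix n n ℂ} (hA : A.PosDef) (p : ℝ) : (mpow A p).PosDef := by
  rw [mpow_eq_rpow hA]
  have := hA.isStrictlyPositive
  exact (IsStrictlyPositive.rpow A p).posDef

lemma mpow_mul_mpow {A : Matrix n n ℂ} (hA : A.PosDef) (p q : ℝ) :
    mpow A p * mpow A q = mpow A (p + q) := by
  rw [mpow_eq_rpow hA, mpow_eq_rpow hA, mpow_eq_rpow hA,
    CFC.rpow_add hA.isStrictlyPositive.isUnit]

lemma mpow_mpow {A : Matrix n n ℂ} (hA : A.PosDef) {p : ℝ} (hp : p ≠ 0) (q : ℝ) :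
    mpow (mpow A p) q = mpow A (p * q) := by
  rw [mpow_eq_rpow (posDef_mpow hA p), mpow_eq_rpow hA, mpow_eq_rpow hA,
    CFC.rpow_rpow A p q hp hA.isStrictlyPositive]

lemma mpow_zero {A : Matrix n n ℂ} (hA : A.PosDef) : mpow A 0 = 1 := by
  rw [mpow_eq_rpow hA, CFC.rpow_zero A hA.posSemidef.nonneg]

lemma mpow_one {A : Matrix n n ℂ} (hA : A.PosDef) : mpow A 1 = A := by
  rw [mpow_eq_rpow hA, CFC.rpow_one A hA.posSemidef.nonneg]

lemma conjTranspose_mpow {A : Matrix n n ℂ} (hA : A.PosDef) (p : ℝ) : (mpow A p)ᴴ = mpow A p :=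
  (posDef_mpow hA p).isHermitian

lemma posDef_mul_mul_mpow {A B : Matrix n n ℂ} (hA : A.PosDef) (hB : B.PosDef) (p : ℝ) :
    (mpow A p * B * mpow A p).PosDef := by
  have hU : IsUnit (mpow A p) := (posDef_mpow hA p).isUnit
  have h := hU.posDef_star_left_conjugate_iff.mpr hB
  rwa [star_eq_conjTranspose, conjTranspose_mpow hA] at h

lemma posDef_gm {A B : Matrix n n ℂ} (hA : A.PosDef) (hB : B.PosDef) (t : ℝ) :
    (gm A B t).PosDef :=
  posDef_mul_mul_mpow hA (posDef_mpow (posDef_mul_mul_mpow hA hB _) t) _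

lemma mpow_conj {W : Matrix n m ℂ} (hW : Wᴴ * W = 1) (hW' : W * Wᴴ = 1) {A : Matrix n n ℂ}
    (hA : A.PosDef) (p : ℝ) : mpow (Wᴴ * A * W) p = Wᴴ * mpow A p * W :=
  cfc_conj hW hW' hA.isHermitian _

lemma gm_conj {W : Matrix n m ℂ} (hW : Wᴴ * W = 1) (hW' : W * Wᴴ = 1) {A B : Matrix n n ℂ}
    (hA : A.PosDef) (hB : B.PosDef) (t : ℝ) :
    gm (Wᴴ * A * W) (Wᴴ * B * W) t = Wᴴ * gm A B t * W := by
  have hmul : ∀ P Q : Matrix n n ℂ, Wᴴ * P * W * (Wᴴ * Q * W) = Wᴴ * (P * Q) * W := by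
    intro P Q
    calc _ = Wᴴ * P * (W * Wᴴ) * Q * W := by simp only [Matrix.mul_assoc]
      _ = _ := by rw [hW', Matrix.mul_one, Matrix.mul_assoc Wᴴ]
  simp only [gm, mpow_conj hW hW' hA, hmul,
    mpow_conj hW hW' (posDef_mul_mul_mpow hA hB _)]

lemma mpow_half_mul_mpow_neg_half {A : Matrix n n ℂ} (hA : A.PosDef) :
    mpow A (1 / 2) * mpow A (-(1 / 2)) = 1 := by
  rw [mpow_mul_mpow hA, add_neg_cancel, mpow_zero hA]

lemma mpow_half_mul_self {A : Matrix n n ℂ} (hA : A.PosDef) :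
    mpow A (1 / 2) * mpow A (1 / 2) = A := by
  rw [mpow_mul_mpow hA, add_halves, mpow_one hA]

lemma mpow_smul {A : Matrix n n ℂ} (hA : A.PosDef) {c : ℝ} (hc : 0 < c) (p : ℝ) :
    mpow (c • A) p = c ^ p • mpow A p := by
  have hfin := A.finite_real_spectrum
  have hA' : IsSelfAdjoint A := hA.isHermitian
  rw [mpow, mpow, ← cfc_smul_id (R := ℝ) c A, ← cfc_comp (fun x : ℝ => x ^ p) (c • ·) A hA'
    ((hfin.image _).continuousOn _) (hfin.continuousOn _),
    ← cfc_smul (c ^ p) (fun x : ℝ => x ^ p) A (hfin.continuousOn _)]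
  refine cfc_congr fun x hx => ?_
  have hx0 : 0 ≤ x := spectrum_nonneg_of_nonneg hA.posSemidef.nonneg hx
  simp [Real.mul_rpow hc.le hx0]

lemma mlog_mpow {A : Matrix n n ℂ} (hA : A.PosDef) (p : ℝ) : mlog (mpow A p) = p • mlog A := by
  have hfin := A.finite_real_spectrum
  have hA' : IsSelfAdjoint A := hA.isHermitian
  rw [mlog, mpow, mlog, ← cfc_comp Real.log (fun x : ℝ => x ^ p) A hA'
    ((hfin.image _).continuousOn _) (hfin.continuousOn _),
    ← cfc_smul p Real.log A (hfin.continuousOn _)]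
  refine cfc_congr fun x hx => ?_
  have hx0 : 0 < x := hA.isStrictlyPositive.spectrum_pos hx
  simp [Real.log_rpow hx0]

/-- Inverting the weighted geometric mean in its second argument. -/
lemma eq_gm_gm {A B : Matrix n n ℂ} (hA : A.PosDef) (hB : B.PosDef) {t : ℝ} (ht : t ≠ 0) :
    B = gm A (gm A B t) t⁻¹ := by
  have h0' := mpow_half_mul_mpow_neg_half hA
  have h0 := mul_eq_one_comm.mp h0'
  have cancel : ∀ P Q R : Matrix n n ℂ, P * Q = 1 → Q * P = 1 → P * (Q * R * Q) * P = R := by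
    intro P Q R h h'
    calc _ = (P * Q) * R * (Q * P) := by simp only [Matrix.mul_assoc]
      _ = R := by rw [h, h', Matrix.one_mul, Matrix.mul_one]
  have hT := posDef_mul_mul_mpow hA hB (-(1 / 2))
  rw [gm, gm, cancel _ _ _ h0 h0', mpow_mpow hT ht, mul_inv_cancel₀ ht, mpow_one hT,
    cancel _ _ _ h0' h0]

lemma gm_comm {A G : Matrix n n ℂ} (hA : A.PosDef) (hG : G.PosDef) (s : ℝ) :
    gm A G s = gm G A (1 - s) := by
  set a := mpow A (1 / 2) with ha
  set a' := mpow A (-(1 / 2)) with ha'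
  set g := mpow G (1 / 2) with hg
  set g' := mpow G (-(1 / 2)) with hg'
  have haa' : a * a' = 1 := mpow_half_mul_mpow_neg_half hA
  have haa : a * a = A := mpow_half_mul_self hA
  have ha'a : a' * a = 1 := mul_eq_one_comm.mp haa'
  have hgg' : g * g' = 1 := mpow_half_mul_mpow_neg_half hG
  have hgg : g * g = G := mpow_half_mul_self hG
  have hg'g : g' * g = 1 := mul_eq_one_comm.mp hgg'
  have hP : (a' * G * a').PosDef := posDef_mul_mul_mpow hA hG _
  have hR : (g' * A * g').PosDef := posDef_mul_mul_mpow hG hA _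
  have hQR : (g * (a' * a') * g) * (g' * A * g') = 1 := by
    rw [← haa]
    calc _ = g * (a' * (a' * ((g * g') * a)) * a) * g' := by simp only [Matrix.mul_assoc]
      _ = 1 := by simp only [hgg', ha'a, Matrix.one_mul, Matrix.mul_one]
  have hQ : g * (a' * a') * g = mpow (g' * A * g') (-1) := by
    have h := mpow_mul_mpow hR (-1) 1
    rw [mpow_one hR, neg_add_cancel, mpow_zero hR] at h
    exact (left_inv_eq_right_inv h (mul_eq_one_comm.mp hQR)).symm
  have hQpd : (g * (a' * a') * g).PosDef := hQ ▸ posDef_mpow hR _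
  have hint : (g' * a) * (a' * G * a') = (g * (a' * a') * g) * (g' * a) := by
    rw [← hgg]
    calc _ = g' * (a * a') * g * g * a' := by simp only [Matrix.mul_assoc]
      _ = g * a' := by rw [haa', Matrix.mul_one, hg'g, Matrix.one_mul]
      _ = g * (a' * (a' * ((g * g') * a))) := by
        rw [hgg', Matrix.one_mul, ha'a, Matrix.mul_one]
      _ = _ := by simp only [Matrix.mul_assoc]
  have hpow : (g' * a) * mpow (a' * G * a') s = mpow (g * (a' * a') * g) s * (g' * a) :=
    mul_cfc_of_intertwine hP.isHermitian hQpd.isHermitian hint _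
  calc gm A G s = g * ((g' * a) * mpow (a' * G * a') s) * (a * g') * g := by
        rw [gm, ← ha, ← ha']
        calc _ = (g * g') * a * mpow (a' * G * a') s * a * (g' * g) := by
              rw [hgg', hg'g, Matrix.one_mul, Matrix.mul_one]
          _ = _ := by simp only [Matrix.mul_assoc]
    _ = g * (mpow (g * (a' * a') * g) s * (g' * A * g')) * g := by
        rw [hpow, ← haa]; simp only [Matrix.mul_assoc]
    _ = gm G A (1 - s) := by
        rw [gm, ← hg, ← hg', hQ, mpow_mpow hR (by norm_num)]
        have h := mpow_mul_mpow hR (-1 * s) 1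
        rw [mpow_one hR, show -1 * s + 1 = 1 - s by ring] at h
        rw [h]

lemma gm_le_of_le_smul_one {A G : Matrix n n ℂ} (hA : A.PosDef) (hG : G.PosDef) {c s : ℝ}
    (hc : 0 < c) (hAc : A ≤ c • (1 : Matrix n n ℂ)) (hs : s ∈ Set.Icc (0 : ℝ) 1) :
    gm A G s ≤ c ^ (1 - s) • mpow G s := by
  have conj : ∀ (p : ℝ) {P Q : Matrix n n ℂ}, P ≤ Q →
      mpow G p * P * mpow G p ≤ mpow G p * Q * mpow G p := by
    intro p P Q h
    have := star_left_conjugate_le_conjugate h (mpow G p)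
    rwa [star_eq_conjTranspose, conjTranspose_mpow hG] at this
  have h1 : mpow G (-(1 / 2)) * A * mpow G (-(1 / 2)) ≤ c • mpow G (-1) := by
    refine (conj _ hAc).trans_eq ?_
    rw [Matrix.mul_smul, Matrix.smul_mul, Matrix.mul_one, mpow_mul_mpow hG]
    norm_num
  have h2 : mpow (mpow G (-(1 / 2)) * A * mpow G (-(1 / 2))) (1 - s) ≤
      c ^ (1 - s) • mpow G (s - 1) := by
    have hpd := posDef_mpow hG (-1)
    have hcpd : (c • mpow G (-1)).PosDef := hpd.smul hc
    have h := CFC.rpow_le_rpow (p := 1 - s) ⟨by linarith [hs.2], by linarith [hs.1]⟩ h1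
    rw [← mpow_eq_rpow (posDef_mul_mul_mpow hG hA _), ← mpow_eq_rpow hcpd, mpow_smul hpd hc,
      mpow_mpow hG (by norm_num)] at h
    simpa using h
  rw [gm_comm hA hG]
  refine (conj _ h2).trans_eq ?_
  rw [Matrix.mul_smul, Matrix.smul_mul, mpow_mul_mpow hG, mpow_mul_mpow hG]
  congr 2; ring

lemma smul_mlog_le {A B : Matrix n n ℂ} (hA : A.PosDef) (hB : B.PosDef) {c t : ℝ}
    (hc : 0 < c) (hAc : A ≤ c • (1 : Matrix n n ℂ)) (ht : 1 ≤ t) :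
    t • mlog B ≤ ((t - 1) * Real.log c) • (1 : Matrix n n ℂ) + mlog (gm A B t) := by
  have ht0 : 0 < t := by linarith
  have hG := posDef_gm hA hB t
  have hGs := posDef_mpow hG t⁻¹
  have h := gm_le_of_le_smul_one hA hG hc hAc (s := t⁻¹) ⟨by positivity, inv_le_one_of_one_le₀ ht⟩
  rw [← eq_gm_gm hA hB ht0.ne'] at h
  have hlog := CFC.log_le_log h hB.isStrictlyPositive
  rw [CFC.log_smul' _ (Real.rpow_pos_of_pos hc _) hGs.isStrictlyPositive, Real.log_rpow hc] at hlog
  change mlog B ≤ _ + mlog _ at hlog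
  rw [mlog_mpow hG, Algebra.algebraMap_eq_smul_one] at hlog
  have h' := smul_le_smul_of_nonneg_left hlog ht0.le
  refine h'.trans_eq ?_
  rw [smul_add, smul_smul, smul_smul, mul_inv_cancel₀ ht0.ne', one_smul]
  congr 2
  field_simp

end GeometricMean

section Majorization

variable {m k : ℕ}

lemma posDef_mul_diagonal_mul {ι : Type*} [Fintype ι] [DecidableEq ι] {U : Matrix ι ι ℂ}
    (hU' : U * Uᴴ = 1) {d : ι → ℝ} (hd : ∀ i, 0 < d i) :
    (U * diagonal (fun i => (d i : ℂ)) * Uᴴ).PosDef := by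
  refine Matrix.PosDef.mul_mul_conjTranspose_same (Matrix.PosDef.diagonal fun i => ?_)
    (Function.LeftInverse.injective (g := fun v => Uᴴ.vecMul v) fun v => ?_)
  · simpa using hd i
  · simp only [Matrix.vecMul_vecMul, hU', Matrix.vecMul_one]

lemma posDef_compound {A : Matrix (Fin m) (Fin m) ℂ} (hA : A.PosDef) : (compound k A).PosDef := by
  obtain ⟨U, d, hU, hU', -, hd, rfl⟩ := hA.exists_antitone_diagonalization (Fintype.card_fin m)
  rw [compound_mul_diagonal_mul]
  exact posDef_mul_diagonal_mul (compound_mul_conjTranspose_self hU')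
    fun s => Finset.prod_pos fun i _ => hd _

lemma mpow_compound {A : Matrix (Fin m) (Fin m) ℂ} (hA : A.PosDef) (p : ℝ) :
    mpow (compound k A) p = compound k (mpow A p) := by
  obtain ⟨U, d, hU, hU', -, hd, rfl⟩ := hA.exists_antitone_diagonalization (Fintype.card_fin m)
  rw [mpow, mpow, compound_mul_diagonal_mul, cfc_mul_diagonal_mul hU hU',
    cfc_mul_diagonal_mul (conjTranspose_compound_mul_self hU) (compound_mul_conjTranspose_self hU'),
    compound_mul_diagonal_mul]
  simp only [Real.finsetProd_rpow _ _ fun i _ => (hd _).le]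

lemma gm_compound {A B : Matrix (Fin m) (Fin m) ℂ} (hA : A.PosDef) (hB : B.PosDef) (t : ℝ) :
    gm (compound k A) (compound k B) t = compound k (gm A B t) := by
  simp only [gm, mpow_compound hA, ← compound_mul, mpow_compound (posDef_mul_mul_mpow hA hB _)]

lemma mlog_compound_apply_self {A : Matrix (Fin m) (Fin m) ℂ} (hA : A.PosDef)
    (s : Fin k ↪o Fin m) : mlog (compound k A) s s = ∑ i, mlog A (s i) (s i) := by
  obtain ⟨U, d, hU, hU', -, hd, rfl⟩ := hA.exists_antitone_diagonalization (Fintype.card_fin m)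
  rw [mlog, mlog, compound_mul_diagonal_mul, cfc_mul_diagonal_mul hU hU',
    cfc_mul_diagonal_mul (conjTranspose_compound_mul_self hU) (compound_mul_conjTranspose_self hU'),
    ← compound_mul_diagonal_sum_mul_apply hU']
  have : (fun t : Fin k ↪o Fin m => ((Real.log (∏ i, d (t i)) : ℝ) : ℂ)) =
      fun t => ∑ i, ((Real.log (d (t i)) : ℝ) : ℂ) := by
    ext t
    rw [Real.log_prod fun i _ => (hd _).ne']
    push_cast; rfl
  rw [this]

lemma le_orderEmbedding_apply (s : Fin k ↪o Fin m) :
    ∀ (j : ℕ) (hj : j < k), j ≤ (s ⟨j, hj⟩ : ℕ)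
  | 0, _ => Nat.zero_le _
  | j + 1, hj => (le_orderEmbedding_apply s j (by omega)).trans_lt <|
      Fin.lt_def.mp <| s.strictMono <| Fin.mk_lt_mk.mpr j.lt_succ_self

lemma compound_le_smul_one {U : Matrix (Fin m) (Fin m) ℂ} (hU' : U * Uᴴ = 1) {d : Fin m → ℝ}
    (hd : Antitone d) (hpos : ∀ i, 0 < d i) (hk : k ≤ m) :
    compound k (U * diagonal (fun i => (d i : ℂ)) * Uᴴ) ≤
      (∏ i : Fin k, d (Fin.castLE hk i)) • (1 : Matrix (Fin k ↪o Fin m) (Fin k ↪o Fin m) ℂ) := by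
  set c := ∏ i : Fin k, d (Fin.castLE hk i)
  rw [Matrix.le_iff, compound_mul_diagonal_mul]
  have h1 : c • (1 : Matrix (Fin k ↪o Fin m) (Fin k ↪o Fin m) ℂ) =
      compound k U * diagonal (fun _ => (c : ℂ)) * (compound k U)ᴴ := by
    have : diagonal (fun _ => (c : ℂ)) = c • (1 : Matrix (Fin k ↪o Fin m) (Fin k ↪o Fin m) ℂ) := by
      ext i j; by_cases h : i = j <;> simp [h]
    rw [this, Matrix.mul_smul, Matrix.smul_mul, Matrix.mul_one,
      compound_mul_conjTranspose_self hU']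
  rw [h1, ← Matrix.sub_mul, ← Matrix.mul_sub, Matrix.diagonal_sub]
  refine Matrix.PosSemidef.mul_mul_conjTranspose_same (Matrix.PosSemidef.diagonal fun s => ?_) _
  rw [Pi.zero_apply, ← Complex.ofReal_sub, Complex.zero_le_real, sub_nonneg]
  refine Finset.prod_le_prod (fun i _ => (hpos _).le) fun i _ => hd ?_
  exact Fin.le_def.mpr (le_orderEmbedding_apply s i i.isLt)

/-- A Ky Fan type inequality for the leading diagonal entries of `log (A #_t B) - t log B`. -/
lemma sum_re_mlog_gm_sub_nonneg {A B U : Matrix (Fin m) (Fin m) ℂ} (hA : A.PosDef) (hB : B.PosDef)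
    (hU' : U * Uᴴ = 1) {d : Fin m → ℝ} (hd : Antitone d) (hpos : ∀ i, 0 < d i)
    (hAU : A = U * diagonal (fun i => (d i : ℂ)) * Uᴴ) {t : ℝ} (ht : 1 ≤ t) (hk : k ≤ m) :
    0 ≤ ∑ i : Fin k, ((t - 1) * Real.log (d (Fin.castLE hk i)) +
      (mlog (gm A B t) (Fin.castLE hk i) (Fin.castLE hk i)).re -
        t * (mlog B (Fin.castLE hk i) (Fin.castLE hk i)).re) := by
  have hle := hAU ▸ compound_le_smul_one hU' hd hpos hk
  have h := smul_mlog_le (posDef_compound (k := k) hA) (posDef_compound (k := k) hB)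
    (Finset.prod_pos fun i _ => hpos _) hle ht
  rw [gm_compound hA hB, Matrix.le_iff] at h
  have h' := h.diag_nonneg (i := Fin.castLEOrderEmb hk)
  rw [Matrix.sub_apply, Matrix.add_apply, Matrix.smul_apply, Matrix.smul_apply,
    mlog_compound_apply_self hB, mlog_compound_apply_self (posDef_gm hA hB t),
    Real.log_prod fun i _ => (hpos _).ne'] at h'
  have h'' := (Complex.le_def.mp h').1
  simpa [Finset.sum_add_distrib, Finset.sum_sub_distrib, Finset.mul_sum] using h''

/-- Abel summation. -/
lemma sum_mul_nonneg_of_antitone {x h : Fin m → ℝ} (hx : Antitone x) (hpos : ∀ i, 0 ≤ x i)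
    (hh : ∀ (k : ℕ) (hk : k ≤ m), 0 ≤ ∑ i : Fin k, h (Fin.castLE hk i)) :
    0 ≤ ∑ i, x i * h i := by
  induction m with
  | zero => simp
  | succ m ih =>
    have h1 : 0 ≤ ∑ i : Fin m, (x i.castSucc - x (Fin.last m)) * h i.castSucc := by
      refine ih (x := fun i => x i.castSucc - x (Fin.last m)) (h := fun i => h i.castSucc)
        (fun i j hij => ?_) (fun i => ?_) (fun k hk => ?_)
      · exact sub_le_sub_right (hx (Fin.castSucc_le_castSucc_iff.mpr hij)) _
      · exact sub_nonneg.mpr (hx (Fin.le_last _))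
      · exact hh k (by omega)
    have h2 : 0 ≤ x (Fin.last m) * ∑ i, h i :=
      mul_nonneg (hpos _) (by simpa using hh (m + 1) le_rfl)
    rw [Fin.sum_univ_castSucc] at h2 ⊢
    simp only [sub_mul, Finset.sum_sub_distrib, ← Finset.mul_sum] at h1
    linarith

/-- The scalar Gibbs inequality. -/
lemma sum_mul_log_le_sum_mul_log {ι : Type*} [Fintype ι] {x z : ι → ℝ} (hx : ∀ i, 0 < x i)
    (hz : ∀ i, 0 < z i) (h : ∑ i, z i = ∑ i, x i) :
    ∑ i, x i * Real.log (z i) ≤ ∑ i, x i * Real.log (x i) := by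
  have key : ∀ i, x i * Real.log (z i) - x i * Real.log (x i) ≤ z i - x i := by
    intro i
    have h1 := Real.log_le_sub_one_of_pos (div_pos (hz i) (hx i))
    rw [Real.log_div (hz i).ne' (hx i).ne'] at h1
    have h2 := mul_le_mul_of_nonneg_left h1 (hx i).le
    have h3 : x i * (z i / x i - 1) = z i - x i := by
      have := (hx i).ne'
      field_simp
    linarith
  have := Finset.sum_le_sum fun i (_ : i ∈ Finset.univ) => key i
  rw [Finset.sum_sub_distrib, Finset.sum_sub_distrib, h] at this
  linarith

end Majorization

lemma rtr_diagonal_mul {m : ℕ} (x : Fin m → ℝ) (K : Matrix (Fin m) (Fin m) ℂ) :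
    rtr (diagonal (fun i => (x i : ℂ)) * K) = ∑ i, x i * (K i i).re := by
  simp [rtr, Matrix.trace, Matrix.diagonal_mul]

theorem stmt5 {n : Type*} [Fintype n] [DecidableEq n]
    (X Y Z : Matrix n n ℂ) (hX : X.PosDef) (hY : Y.PosDef) (hZ : Z.PosDef)
    (htr : Z.trace = X.trace) (t r : ℝ) (ht : 1 ≤ t) (hr : 0 < r) :
    rtr (X * mlog (gm (mpow Z r) (mpow Y r) t)) ≥
      rtr (X * ((1 - t) • mlog (mpow X r) + t • mlog (mpow Y r))) := by
  obtain ⟨W, x, hW, hW', hx, hxpos, hXW⟩ := hX.exists_antitone_diagonalization rfl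
  obtain ⟨V, z, hV, hV', hz, hzpos, hZV⟩ := hZ.exists_antitone_diagonalization rfl
  set D := diagonal (fun i => (x i : ℂ)) with hD
  have hrtr : ∀ K : Matrix n n ℂ, rtr (X * K) = ∑ i, x i * ((Wᴴ * K * W) i i).re := by
    intro K
    rw [← rtr_diagonal_mul, ← hD, rtr, rtr, hXW, Matrix.mul_assoc, Matrix.mul_assoc,
      Matrix.trace_mul_comm]
    simp only [Matrix.mul_assoc]
  have htrace : ∀ (P : Matrix n (Fin (Fintype.card n)) ℂ) (d : Fin (Fintype.card n) → ℝ),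
      Pᴴ * P = 1 → (P * diagonal (fun i => (d i : ℂ)) * Pᴴ).trace = ((∑ i, d i : ℝ) : ℂ) := by
    intro P d hP
    rw [Matrix.trace_mul_comm, ← Matrix.mul_assoc, hP, Matrix.one_mul, Matrix.trace_diagonal]
    simp
  have hsum : ∑ i, z i = ∑ i, x i := by
    rw [hXW, hZV, htrace V z hV, htrace W x hW] at htr
    exact_mod_cast htr
  have hA := posDef_mpow hZ r
  have hB := posDef_mpow hY r
  have hpd : ∀ {K : Matrix n n ℂ}, K.PosDef → (Wᴴ * K * W).PosDef := fun hK =>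
    hK.conjTranspose_mul_mul_same <| Function.LeftInverse.injective (g := Wᴴ.mulVec) fun v => by
      rw [Matrix.mulVec_mulVec, hW, Matrix.one_mulVec]
  have hlog : ∀ {K : Matrix n n ℂ}, K.PosDef → Wᴴ * mlog K * W = mlog (Wᴴ * K * W) := fun hK =>
    (cfc_conj hW hW' hK.isHermitian _).symm
  have hAU : Wᴴ * mpow Z r * W =
      (Wᴴ * V) * diagonal (fun i => ((z i ^ r : ℝ) : ℂ)) * (Wᴴ * V)ᴴ := by
    rw [mpow, hZV, cfc_mul_diagonal_mul hV hV', Matrix.conjTranspose_mul,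
      Matrix.conjTranspose_conjTranspose]
    simp only [Matrix.mul_assoc]
  have hWV : (Wᴴ * V) * (Wᴴ * V)ᴴ = 1 := by
    rw [Matrix.conjTranspose_mul, Matrix.conjTranspose_conjTranspose]
    calc _ = Wᴴ * (V * Vᴴ) * W := by simp only [Matrix.mul_assoc]
      _ = 1 := by rw [hV', Matrix.mul_one, hW]
  have hmain := sum_mul_nonneg_of_antitone
    (h := fun i => (t - 1) * Real.log (z i ^ r) +
      (mlog (gm (Wᴴ * mpow Z r * W) (Wᴴ * mpow Y r * W) t) i i).re -
        t * (mlog (Wᴴ * mpow Y r * W) i i).re) hx (fun i => (hxpos i).le) fun k hk =>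
    sum_re_mlog_gm_sub_nonneg (hpd hA) (hpd hB) hWV
      (fun i j hij => Real.rpow_le_rpow (hzpos _).le (hz hij) hr.le)
      (fun i => Real.rpow_pos_of_pos (hzpos i) r) hAU ht hk
  rw [gm_conj hW hW' hA hB, ← hlog (posDef_gm hA hB t), ← hlog hB] at hmain
  have hlogX : Wᴴ * mlog X * W = diagonal (fun i => (Real.log (x i) : ℂ)) := by
    rw [mlog, hXW, cfc_mul_diagonal_mul hW hW']
    calc _ = (Wᴴ * W) * diagonal (fun i => (Real.log (x i) : ℂ)) * (Wᴴ * W) := by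
          simp only [Matrix.mul_assoc]
      _ = _ := by rw [hW, Matrix.one_mul, Matrix.mul_one]
  have hgibbs := mul_le_mul_of_nonneg_left (sum_mul_log_le_sum_mul_log hxpos hzpos hsum)
    (mul_nonneg (sub_nonneg.mpr ht) hr.le)
  have hsplit : ∑ i, x i * ((Wᴴ * ((1 - t) • mlog (mpow X r) + t • mlog (mpow Y r)) * W) i i).re =
      -((t - 1) * r * ∑ i, x i * Real.log (x i)) +
        t * ∑ i, x i * ((Wᴴ * mlog (mpow Y r) * W) i i).re := by
    have : Wᴴ * ((1 - t) • mlog (mpow X r) + t • mlog (mpow Y r)) * W =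
        ((1 - t) * r) • diagonal (fun i => (Real.log (x i) : ℂ)) +
          t • (Wᴴ * mlog (mpow Y r) * W) := by
      rw [mlog_mpow hX, ← hlogX]
      simp only [Matrix.mul_add, Matrix.add_mul, Matrix.mul_smul, Matrix.smul_mul, smul_smul]
    rw [this, Finset.mul_sum, Finset.mul_sum, ← Finset.sum_neg_distrib, ← Finset.sum_add_distrib]
    refine Finset.sum_congr rfl fun i _ => ?_
    simp
    ring
  have hsplit' : ∑ i, x i * ((t - 1) * Real.log (z i ^ r) +
      ((Wᴴ * mlog (gm (mpow Z r) (mpow Y r) t) * W) i i).re -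
        t * ((Wᴴ * mlog (mpow Y r) * W) i i).re) =
      (t - 1) * r * ∑ i, x i * Real.log (z i) +
        ∑ i, x i * ((Wᴴ * mlog (gm (mpow Z r) (mpow Y r) t) * W) i i).re -
        t * ∑ i, x i * ((Wᴴ * mlog (mpow Y r) * W) i i).re := by
    rw [Finset.mul_sum, Finset.mul_sum, ← Finset.sum_add_distrib, ← Finset.sum_sub_distrib]
    refine Finset.sum_congr rfl fun i _ => ?_
    rw [Real.log_rpow (hzpos i)]
    ring
  rw [hsplit'] at hmain
  rw [ge_iff_le, hrtr, hrtr, hsplit]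
  linarith
end

section
/- Any quantum relative entropy R satisfies the Pinsker-type bound R(X‖W) ≥ (1/2) Tr[X] · ‖X/Tr[X] − W/Tr[W]‖₁², where ‖·‖₁ is the trace norm. -/
open Matrix ComplexOrder

/-- The trace norm of a matrix, `Tr[(A^* A)^{1/2}]`. -/
noncomputable def traceNorm {n : Type*} [Fintype n] [DecidableEq n] (A : Matrix n n ℂ) : ℝ :=
  rtr (cfc (fun x : ℝ => Real.sqrt x) (Aᴴ * A))


section

open scoped MatrixOrder Matrix.Norms.L2Operator

/-- A positive definite matrix dominates every Hermitian matrix up to scaling. -/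
theorem Matrix.PosDef.exists_smul_add_posDef {n : Type*} [Fintype n] [DecidableEq n]
    [Nonempty n] {A H : Matrix n n ℂ} (hA : A.PosDef) (hH : H.IsHermitian) :
    ∃ s₀ : ℝ, 0 < s₀ ∧ ∀ s : ℝ, s₀ ≤ s → (s • A + H).PosDef := by
  have hA' : IsStrictlyPositive A := isStrictlyPositive_iff_posDef.2 hA
  obtain ⟨r, hr, hrA⟩ := (CFC.exists_pos_algebraMap_le_iff hA'.isSelfAdjoint).2
    fun x hx ↦ hA'.spectrum_pos hx
  have hH' : IsSelfAdjoint H := hH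
  have h2 := hH'.neg_algebraMap_norm_le_self
  rw [le_iff] at hrA h2
  refine ⟨(‖H‖ + 1) / r, by positivity, fun s hs ↦ ?_⟩
  have hs0 : 0 < s := lt_of_lt_of_le (by positivity) hs
  have hs1 : 0 < s * r - ‖H‖ := by
    rw [div_le_iff₀ hr] at hs
    linarith
  have h3 : ((s * r - ‖H‖) • (1 : Matrix n n ℂ)).PosDef := Matrix.PosDef.one.smul hs1
  have h4 := (h3.add_posSemidef (hrA.smul hs0.le)).add_posSemidef h2
  convert h4 using 1
  simp only [Algebra.algebraMap_eq_smul_one, smul_sub, sub_smul, smul_smul]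
  abel

end

/-- A finite jointly homogeneous and subadditive function on pairs of positive definite matrices
has a supporting linear functional at every point. -/
theorem exists_supporting_functional {n : Type*} [Fintype n] [DecidableEq n] [Nonempty n]
    (S : Matrix n n ℂ → Matrix n n ℂ → ℝ)
    (hadd : ∀ X₁ X₂ W₁ W₂ : Matrix n n ℂ, X₁.PosDef → X₂.PosDef → W₁.PosDef → W₂.PosDef →
      S (X₁ + X₂) (W₁ + W₂) ≤ S X₁ W₁ + S X₂ W₂)
    (hsmul : ∀ (X W : Matrix n n ℂ) (l : ℝ), 0 < l → X.PosDef → W.PosDef →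
      S (l • X) (l • W) = l * S X W)
    (A B : Matrix n n ℂ) (hA : A.PosDef) (hB : B.PosDef) :
    ∃ φ₁ φ₂ : Matrix n n ℂ →ₗ[ℝ] ℝ,
      (∀ X W : Matrix n n ℂ, X.PosDef → W.PosDef → φ₁ X + φ₂ W ≤ S X W) ∧
      φ₁ A + φ₂ B = S A B := by
  let K : PointedCone ℝ (Matrix n n ℂ × Matrix n n ℂ × ℝ) :=
    { carrier := {v | v = 0 ∨ ((v.1 + v.1ᴴ).PosDef ∧ (v.2.1 + v.2.1ᴴ).PosDef ∧
        S (v.1 + v.1ᴴ) (v.2.1 + v.2.1ᴴ) ≤ v.2.2)}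
      zero_mem' := Or.inl rfl
      add_mem' := by
        rintro v w (rfl | ⟨hv1, hv2, hv3⟩) (rfl | ⟨hw1, hw2, hw3⟩)
        · left; simp
        · right; simpa using ⟨hw1, hw2, hw3⟩
        · right; simpa using ⟨hv1, hv2, hv3⟩
        · right
          have e1 : (v + w).1 + (v + w).1ᴴ = (v.1 + v.1ᴴ) + (w.1 + w.1ᴴ) := by
            simp only [Prod.fst_add, conjTranspose_add]; abel
          have e2 : (v + w).2.1 + (v + w).2.1ᴴ = (v.2.1 + v.2.1ᴴ) + (w.2.1 + w.2.1ᴴ) := by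
            simp only [Prod.snd_add, Prod.fst_add, conjTranspose_add]; abel
          rw [e1, e2]
          exact ⟨hv1.add hw1, hv2.add hw2,
            (hadd _ _ _ _ hv1 hw1 hv2 hw2).trans (add_le_add hv3 hw3)⟩
      smul_mem' := by
        rintro ⟨c, hc⟩ v hv
        change c • v = 0 ∨ ((c • v.1 + (c • v.1)ᴴ).PosDef ∧ (c • v.2.1 + (c • v.2.1)ᴴ).PosDef ∧
          S (c • v.1 + (c • v.1)ᴴ) (c • v.2.1 + (c • v.2.1)ᴴ) ≤ c * v.2.2)
        rcases hc.eq_or_lt with rfl | hc'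
        · left; simp
        rcases hv with rfl | ⟨hv1, hv2, hv3⟩
        · left; simp
        · right
          have e1 (M : Matrix n n ℂ) : c • M + (c • M)ᴴ = c • (M + Mᴴ) := by
            simp [conjTranspose_smul]
          rw [e1, e1, hsmul _ _ _ hc' hv1 hv2]
          exact ⟨hv1.smul hc', hv2.smul hc', by gcongr⟩ }
  let L : ℝ × ℝ →ₗ[ℝ] Matrix n n ℂ × Matrix n n ℂ × ℝ :=
    { toFun := fun u ↦ (u.1 • A, u.1 • B, u.2)
      map_add' := by intro u v; simp [add_smul]
      map_smul' := by intro c u; simp [mul_smul] }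
  have hA0 : A ≠ 0 := by
    rintro rfl
    have := hA.trace_pos
    simp at this
  have hL : Function.Injective L := by
    intro u v huv
    simp only [L, LinearMap.coe_mk, AddHom.coe_mk, Prod.mk.injEq] at huv
    exact Prod.ext (smul_left_injective ℝ hA0 huv.1) huv.2.2
  let ψ : ℝ × ℝ →ₗ[ℝ] ℝ :=
    { toFun := fun u ↦ u.2 - 2 * u.1 * S A B
      map_add' := by intro u v; simp; ring
      map_smul' := by intro c u; simp; ring }
  let f : Matrix n n ℂ × Matrix n n ℂ × ℝ →ₗ.[ℝ] ℝ := ⟨LinearMap.range L, ψ ∘ₗ (LinearEquiv.ofInjective L hL).symm⟩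
  have hf (u : ℝ × ℝ) : f ⟨L u, ⟨u, rfl⟩⟩ = u.2 - 2 * u.1 * S A B := by
    have : (LinearEquiv.ofInjective L hL).symm ⟨L u, ⟨u, rfl⟩⟩ = u := by
      rw [LinearEquiv.symm_apply_eq]; rfl
    change ψ ((LinearEquiv.ofInjective L hL).symm ⟨L u, ⟨u, rfl⟩⟩) = _
    rw [this]; rfl
  have hdouble {M : Matrix n n ℂ} (hM : M.IsHermitian) (s : ℝ) :
      s • M + (s • M)ᴴ = (2 * s) • M := by
    rw [conjTranspose_smul, hM.eq, star_trivial, ← two_smul ℝ, smul_smul]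
  obtain ⟨g, hg1, hg2⟩ := riesz_extension K f (by
      rintro ⟨_, u, rfl⟩ hu
      rw [hf]
      rcases hu with hu | ⟨hu1, hu2, hu3⟩
      · have : u = 0 := hL (by simpa using hu)
        simp [this]
      · change (u.1 • A + (u.1 • A)ᴴ).PosDef at hu1
        change S (u.1 • A + (u.1 • A)ᴴ) (u.1 • B + (u.1 • B)ᴴ) ≤ u.2 at hu3
        rw [hdouble hA.1] at hu1 hu3
        rw [hdouble hB.1] at hu3
        have hu0 : 0 < 2 * u.1 := by
          have h1 := hu1.trace_pos
          have h2 := hA.trace_pos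
          rw [trace_smul] at h1
          by_contra h
          push Not at h
          have h3 : (0 : ℂ) ≤ (-(2 * u.1)) • A.trace := smul_nonneg (by linarith) h2.le
          rw [neg_smul] at h3
          exact absurd h1 (not_lt_of_ge (neg_nonneg.1 h3))
        rw [hsmul _ _ _ hu0 hA hB] at hu3
        linarith) (by
      intro y
      have hH (M : Matrix n n ℂ) : (M + Mᴴ).IsHermitian := by
        simp [IsHermitian, add_comm]
      obtain ⟨s, hs, hs'⟩ := hA.exists_smul_add_posDef (hH y.1)
      obtain ⟨t, ht, ht'⟩ := hB.exists_smul_add_posDef (hH y.2.1)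
      let c := max s t
      refine ⟨⟨L (c, S (2 • c • A + (y.1 + y.1ᴴ)) (2 • c • B + (y.2.1 + y.2.1ᴴ)) - y.2.2),
        ⟨_, rfl⟩⟩, Or.inr ?_⟩
      have e {M : Matrix n n ℂ} (hM : M.IsHermitian) (N : Matrix n n ℂ) :
          c • M + N + (c • M + N)ᴴ = 2 • c • M + (N + Nᴴ) := by
        rw [conjTranspose_add, conjTranspose_smul, hM.eq, star_trivial, two_smul]; abel
      change ((c • A + y.1) + (c • A + y.1)ᴴ).PosDef ∧ ((c • B + y.2.1) + (c • B + y.2.1)ᴴ).PosDef ∧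
        S ((c • A + y.1) + (c • A + y.1)ᴴ) ((c • B + y.2.1) + (c • B + y.2.1)ᴴ) ≤
          S (2 • c • A + (y.1 + y.1ᴴ)) (2 • c • B + (y.2.1 + y.2.1ᴴ)) - y.2.2 + y.2.2
      rw [e hA.1, e hB.1]
      have hc : 0 < c := lt_max_of_lt_left hs
      have e2 (M : Matrix n n ℂ) : 2 • c • M = (2 * c) • M := by
        rw [two_smul, ← add_smul, two_mul]
      refine ⟨?_, ?_, by linarith⟩
      · rw [e2]; exact hs' _ (by linarith [le_max_left s t])
      · rw [e2]; exact ht' _ (by linarith [le_max_right s t]))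
  have hgL (u : ℝ × ℝ) : g (L u) = u.2 - 2 * u.1 * S A B := by
    rw [← hf]; exact hg1 ⟨L u, ⟨u, rfl⟩⟩
  have hg01 : g (0, 0, 1) = 1 := by
    have := hgL (0, 1)
    simpa [L] using this
  have hsplit (X W : Matrix n n ℂ) (y : ℝ) : g (X, W, y) = g (X, 0, 0) + g (0, W, 0) + y := by
    have : (X, W, y) = (X, 0, 0) + (0, W, 0) + y • ((0, 0, 1) : Matrix n n ℂ × Matrix n n ℂ × ℝ) := by simp
    rw [this, map_add, map_add, map_smul, hg01]
    simp
  refine ⟨(-(1 / 2 : ℝ)) • g ∘ₗ LinearMap.inl ℝ _ _,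
    (-(1 / 2 : ℝ)) • g ∘ₗ LinearMap.inr ℝ _ _ ∘ₗ LinearMap.inl ℝ _ _, fun X W hX hW ↦ ?_, ?_⟩
  · have h := hg2 (X, W, 2 * S X W) (Or.inr (by
      have e {M : Matrix n n ℂ} (hM : M.PosDef) : M + Mᴴ = (2 : ℝ) • M := by
        rw [hM.1.eq, two_smul]
      change (X + Xᴴ).PosDef ∧ (W + Wᴴ).PosDef ∧ S (X + Xᴴ) (W + Wᴴ) ≤ 2 * S X W
      rw [e hX, e hW, hsmul _ _ _ two_pos hX hW]
      exact ⟨hX.smul two_pos, hW.smul two_pos, le_rfl⟩))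
    rw [hsplit] at h
    change -(1 / 2 : ℝ) * g (X, 0, 0) + -(1 / 2 : ℝ) * g (0, W, 0) ≤ S X W
    linarith
  · have h := hgL (1, 0)
    have h' : L (1, 0) = (A, B, 0) := by simp [L]
    rw [h', hsplit] at h
    change -(1 / 2 : ℝ) * g (A, 0, 0) + -(1 / 2 : ℝ) * g (0, B, 0) = S A B
    simp only at h
    linarith

/-- Pinsker's inequality for distributions on two points. -/
theorem binary_pinsker {p q : ℝ} (hp : p ∈ Set.Ioo (0 : ℝ) 1) (hq : q ∈ Set.Ioo (0 : ℝ) 1) :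
    2 * (p - q) ^ 2 ≤ p * Real.log (p / q) + (1 - p) * Real.log ((1 - p) / (1 - q)) := by
  let g : ℝ → ℝ := fun t ↦ -p * Real.log t - (1 - p) * Real.log (1 - t) - 2 * (p - t) ^ 2
  have hg (t : ℝ) (ht : t ∈ Set.Ioo (0 : ℝ) 1) :
      HasDerivAt g ((t - p) * (1 / (t * (1 - t)) - 4)) t := by
    have ht0 : t ≠ 0 := ht.1.ne'
    have ht1 : 1 - t ≠ 0 := (sub_pos.2 ht.2).ne'
    have h1 := ((Real.hasDerivAt_log ht0).const_mul (-p)).sub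
      ((((hasDerivAt_id t).const_sub 1).log ht1).const_mul (1 - p))
    have h2 := h1.sub ((((hasDerivAt_id t).const_sub p).pow 2).const_mul 2)
    refine h2.congr_deriv ?_
    simp only [id]
    field_simp
    ring
  have hfac (t : ℝ) (ht : t ∈ Set.Ioo (0 : ℝ) 1) : 0 ≤ 1 / (t * (1 - t)) - 4 := by
    have : 0 < t * (1 - t) := mul_pos ht.1 (sub_pos.2 ht.2)
    rw [sub_nonneg, le_div_iff₀ this]
    nlinarith [sq_nonneg (2 * t - 1)]
  have key : g p ≤ g q := by
    rcases le_total q p with h | h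
    · have hsub : Set.Icc q p ⊆ Set.Ioo 0 1 := fun t ht ↦
        ⟨hq.1.trans_le ht.1, ht.2.trans_lt hp.2⟩
      refine antitoneOn_of_deriv_nonpos (convex_Icc q p)
        (fun t ht ↦ (hg t (hsub ht)).continuousAt.continuousWithinAt)
        (fun t ht ↦ (hg t (hsub (interior_subset ht))).differentiableAt.differentiableWithinAt)
        (fun t ht ↦ ?_) (Set.left_mem_Icc.2 h) (Set.right_mem_Icc.2 h) h
      rw [(hg t (hsub (interior_subset ht))).deriv]
      exact mul_nonpos_of_nonpos_of_nonneg (sub_nonpos.2 (interior_subset ht).2)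
        (hfac t (hsub (interior_subset ht)))
    · have hsub : Set.Icc p q ⊆ Set.Ioo 0 1 := fun t ht ↦
        ⟨hp.1.trans_le ht.1, ht.2.trans_lt hq.2⟩
      refine monotoneOn_of_deriv_nonneg (convex_Icc p q)
        (fun t ht ↦ (hg t (hsub ht)).continuousAt.continuousWithinAt)
        (fun t ht ↦ (hg t (hsub (interior_subset ht))).differentiableAt.differentiableWithinAt)
        (fun t ht ↦ ?_) (Set.left_mem_Icc.2 h) (Set.right_mem_Icc.2 h) h
      rw [(hg t (hsub (interior_subset ht))).deriv]
      exact mul_nonneg (sub_nonneg.2 (interior_subset ht).1)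
        (hfac t (hsub (interior_subset ht)))
  rw [Real.log_div hp.1.ne' hq.1.ne',
    Real.log_div (sub_pos.2 hp.2).ne' (sub_pos.2 hq.2).ne']
  simp only [g] at key
  nlinarith

/-- Pinsker's inequality for positive measures on two points. -/
theorem binary_pinsker_unnormalized {x₁ x₂ w₁ w₂ : ℝ} (hx₁ : 0 < x₁) (hx₂ : 0 < x₂)
    (hw₁ : 0 < w₁) (hw₂ : 0 < w₂) :
    2 * (x₁ + x₂) * (x₁ / (x₁ + x₂) - w₁ / (w₁ + w₂)) ^ 2 ≤
      x₁ * Real.log (x₁ / w₁) + x₂ * Real.log (x₂ / w₂) - (x₁ + x₂) + (w₁ + w₂) := by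
  have hx : 0 < x₁ + x₂ := by positivity
  have hw : 0 < w₁ + w₂ := by positivity
  have h := binary_pinsker (p := x₁ / (x₁ + x₂)) (q := w₁ / (w₁ + w₂))
    ⟨by positivity, by rw [div_lt_one hx]; linarith⟩
    ⟨by positivity, by rw [div_lt_one hw]; linarith⟩
  have e1 : 1 - x₁ / (x₁ + x₂) = x₂ / (x₁ + x₂) := by field_simp; ring
  have e2 : 1 - w₁ / (w₁ + w₂) = w₂ / (w₁ + w₂) := by field_simp; ring
  rw [e1, e2] at h
  have elog {a b c d : ℝ} (ha : 0 < a) (hb : 0 < b) (hc : 0 < c) (hd : 0 < d) :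
      Real.log (a / b / (c / d)) = Real.log (a / c) - Real.log (b / d) := by
    rw [← Real.log_div (by positivity) (by positivity)]
    congr 1
    field_simp
  rw [elog hx₁ hx hw₁ hw, elog hx₂ hx hw₂ hw] at h
  have h3 := mul_le_mul_of_nonneg_left h hx.le
  have e3 : (x₁ + x₂) * (x₁ / (x₁ + x₂) * (Real.log (x₁ / w₁) - Real.log ((x₁ + x₂) / (w₁ + w₂))) +
      x₂ / (x₁ + x₂) * (Real.log (x₂ / w₂) - Real.log ((x₁ + x₂) / (w₁ + w₂)))) =
      x₁ * Real.log (x₁ / w₁) + x₂ * Real.log (x₂ / w₂) -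
        (x₁ + x₂) * Real.log ((x₁ + x₂) / (w₁ + w₂)) := by
    field_simp
    ring
  have h4 := Real.one_sub_inv_le_log_of_pos (div_pos hx hw)
  have h5 := mul_le_mul_of_nonneg_left h4 hx.le
  have e5 : (x₁ + x₂) * (1 - ((x₁ + x₂) / (w₁ + w₂))⁻¹) = (x₁ + x₂) - (w₁ + w₂) := by
    field_simp
  rw [e3] at h3
  rw [e5] at h5
  linarith

/-- If `r` maximizes `p ↦ p * u + v - (p * log p - p + 1) * τ` with value zero, then
`u` and `v` are determined. -/
theorem eq_log_mul_of_tangent {r u v τ : ℝ} (hr : 0 < r)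
    (h : ∀ p : ℝ, 0 < p → p * u + v ≤ (p * Real.log p - p + 1) * τ)
    (heq : r * u + v = (r * Real.log r - r + 1) * τ) :
    u = Real.log r * τ ∧ v = (1 - r) * τ := by
  have hmin : IsLocalMin (fun p ↦ (p * Real.log p - p + 1) * τ - (p * u + v)) r := by
    filter_upwards [lt_mem_nhds hr] with p hp
    linarith [h p hp]
  have hd : HasDerivAt (fun p ↦ (p * Real.log p - p + 1) * τ - (p * u + v))
      ((Real.log r + 1 - 1) * τ - 1 * u) r :=
    ((((Real.hasDerivAt_mul_log hr.ne').sub (hasDerivAt_id r)).add_const 1).mul_const τ).sub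
      (((hasDerivAt_id r).mul_const u).add_const v)
  have := hmin.hasDerivAt_eq_zero hd
  have hu : u = Real.log r * τ := by linarith
  refine ⟨hu, ?_⟩
  rw [hu] at heq
  linarith

/-- The real part of the trace, as a real linear functional. -/
noncomputable def rtrLinear (n : Type*) [Fintype n] [DecidableEq n] : Matrix n n ℂ →ₗ[ℝ] ℝ :=
  Complex.reLm ∘ₗ (Matrix.traceLinearMap n ℝ ℂ)

theorem rtrLinear_apply {n : Type*} [Fintype n] [DecidableEq n] (A : Matrix n n ℂ) :
    rtrLinear n A = rtr A := rfl

theorem rtr_mul_comm {n : Type*} [Fintype n] [DecidableEq n] (A B : Matrix n n ℂ) :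
    rtr (A * B) = rtr (B * A) := by
  rw [rtr, rtr, trace_mul_comm]

theorem le_of_forall_pos_add_mul_le {a b c d : ℝ} (h : ∀ ε : ℝ, 0 < ε → a + ε * b ≤ c + ε * d) :
    a ≤ c := by
  by_contra! hac
  have hpos : 0 < |d - b| + 1 := by positivity
  have h1 := h ((a - c) / (|d - b| + 1)) (div_pos (sub_pos.2 hac) hpos)
  have h2 : (a - c) / (|d - b| + 1) * (d - b) < a - c := by
    rw [div_mul_eq_mul_div, div_lt_iff₀ hpos]
    have := le_abs_self (d - b)
    nlinarith
  linarith

/-- A linear functional that is nonnegative on positive semidefinite matrices and vanishes at an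
orthogonal projection vanishes on the corner and off-diagonal blocks of that projection. -/
theorem map_block_eq_zero {n : Type*} [Fintype n] [DecidableEq n] [Nonempty n]
    (g : Matrix n n ℂ →ₗ[ℝ] ℝ) (hg : ∀ Z : Matrix n n ℂ, Z.PosSemidef → 0 ≤ g Z)
    {P : Matrix n n ℂ} (hP : P.IsHermitian) (hPP : P * P = P) (hgP : g P = 0)
    {Z : Matrix n n ℂ} (hZ : Z.PosSemidef) :
    g (P * Z * P) = 0 ∧ g (P * Z * (1 - P) + (1 - P) * Z * P) = 0 := by
  have hcorner : g (P * Z * P) = 0 := by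
    refine le_antisymm ?_ (hg _ (by simpa [hP.eq] using hZ.mul_mul_conjTranspose_same P))
    obtain ⟨s, -, hs⟩ := Matrix.PosDef.one.exists_smul_add_posDef hZ.1.neg
    have h := hg _ (by
      simpa [hP.eq] using ((hs s le_rfl).posSemidef.mul_mul_conjTranspose_same P))
    have e : P * (s • 1 + -Z) * P = s • P - P * Z * P := by
      simp [mul_add, add_mul, hPP, sub_eq_add_neg]
    rw [e, map_sub, map_smul, hgP, smul_zero] at h
    linarith
  refine ⟨hcorner, ?_⟩
  have hquad (t : ℝ) : 0 ≤ t * g (P * Z * (1 - P) + (1 - P) * Z * P) +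
      t ^ 2 * g ((1 - P) * Z * (1 - P)) := by
    have hT : (P + t • (1 - P)).IsHermitian := by
      simp [IsHermitian, hP.eq]
    have h := hg _ (hZ.mul_mul_conjTranspose_same (P + t • (1 - P)))
    rw [hT.eq] at h
    have e : (P + t • (1 - P)) * Z * (P + t • (1 - P)) = P * Z * P +
        t • (P * Z * (1 - P) + (1 - P) * Z * P) + t ^ 2 • ((1 - P) * Z * (1 - P)) := by
      rw [add_mul, add_mul, mul_add, smul_mul_assoc, smul_mul_assoc, mul_add,
        mul_smul_comm, mul_smul_comm, smul_add, smul_smul, smul_add, pow_two]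
      abel
    rw [e, map_add, map_add, map_smul, map_smul, hcorner] at h
    simpa using h
  apply le_antisymm
  · refine le_of_forall_pos_add_mul_le (b := 0) (d := g ((1 - P) * Z * (1 - P))) fun ε hε ↦ ?_
    have := hquad (-ε)
    nlinarith
  · refine le_of_forall_pos_add_mul_le (b := 0) (d := g ((1 - P) * Z * (1 - P))) fun ε hε ↦ ?_
    have := hquad ε
    nlinarith

/-- A positive combination of complementary projections is positive definite. -/
theorem posDef_smul_projection_add {n : Type*} [Fintype n] [DecidableEq n]
    {P : Matrix n n ℂ} (hP : P.IsHermitian) (hPP : P * P = P) {r₁ r₂ : ℝ}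
    (hr₁ : 0 < r₁) (hr₂ : 0 < r₂) : (r₁ • P + r₂ • (1 - P)).PosDef := by
  have hQ : (1 - P).IsHermitian := by simp [IsHermitian, hP.eq]
  have hQQ : (1 - P) * (1 - P) = 1 - P := by
    simp [mul_sub, sub_mul, hPP]
  have hPpsd : P.PosSemidef := by
    simpa [hP.eq, hPP] using posSemidef_conjTranspose_mul_self P
  have hQpsd : (1 - P).PosSemidef := by
    have := posSemidef_conjTranspose_mul_self (1 - P)
    rwa [hQ.eq, hQQ] at this
  have hm : 0 < min r₁ r₂ := lt_min hr₁ hr₂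
  have h1 : (min r₁ r₂ • (1 : Matrix n n ℂ)).PosDef := Matrix.PosDef.one.smul hm
  have h := (h1.add_posSemidef (hPpsd.smul (sub_nonneg.2 (min_le_left r₁ r₂)))).add_posSemidef
    (hQpsd.smul (sub_nonneg.2 (min_le_right r₁ r₂)))
  convert h using 1
  simp only [sub_smul, smul_sub]
  abel

/-- The lower bound by the two-outcome measurement `(P, 1 - P)`. -/
theorem binary_measurement_le {n : Type*} [Fintype n] [DecidableEq n] [Nonempty n]
    (S : Matrix n n ℂ → Matrix n n ℂ → ℝ)
    (hadd : ∀ X₁ X₂ W₁ W₂ : Matrix n n ℂ, X₁.PosDef → X₂.PosDef → W₁.PosDef → W₂.PosDef →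
      S (X₁ + X₂) (W₁ + W₂) ≤ S X₁ W₁ + S X₂ W₂)
    (hsmul : ∀ (X W : Matrix n n ℂ) (l : ℝ), 0 < l → X.PosDef → W.PosDef →
      S (l • X) (l • W) = l * S X W)
    (hprop : ∀ (Z : Matrix n n ℂ) (p : ℝ), Z.PosDef → 0 < p →
      S (p • Z) Z = (p * Real.log p - p + 1) * rtr Z)
    {P : Matrix n n ℂ} (hP : P.IsHermitian) (hPP : P * P = P) {r₁ r₂ : ℝ}
    (hr₁ : 0 < r₁) (hr₂ : 0 < r₂) (hr : r₁ ≠ r₂)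
    (hbase : S (r₁ • P + r₂ • (1 - P)) 1 = (r₁ * Real.log r₁ - r₁ + 1) * rtr P +
      (r₂ * Real.log r₂ - r₂ + 1) * rtr (1 - P))
    {X W : Matrix n n ℂ} (hX : X.PosDef) (hW : W.PosDef) :
    Real.log r₁ * rtr (P * X) + Real.log r₂ * rtr ((1 - P) * X) +
      (1 - r₁) * rtr (P * W) + (1 - r₂) * rtr ((1 - P) * W) ≤ S X W := by
  have hQ : (1 - P).IsHermitian := by simp [IsHermitian, hP.eq]
  have hQQ : (1 - P) * (1 - P) = 1 - P := by
    simp [mul_sub, sub_mul, hPP]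
  have hPpsd : P.PosSemidef := by
    simpa [hP.eq, hPP] using posSemidef_conjTranspose_mul_self P
  have hQpsd : (1 - P).PosSemidef := by
    have := posSemidef_conjTranspose_mul_self (1 - P)
    rwa [hQ.eq, hQQ] at this
  have hA := posDef_smul_projection_add hP hPP hr₁ hr₂
  obtain ⟨φ₁, φ₂, hφ, hφA⟩ := exists_supporting_functional S hadd hsmul _ 1 hA .one
  have hpsd (Z : Matrix n n ℂ) (hZ : Z.PosSemidef) (p : ℝ) (hp : 0 < p) :
      p * φ₁ Z + φ₂ Z ≤ (p * Real.log p - p + 1) * rtr Z := by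
    refine le_of_forall_pos_add_mul_le (b := p * φ₁ 1 + φ₂ 1)
      (d := (p * Real.log p - p + 1) * rtr (1 : Matrix n n ℂ)) fun ε hε ↦ ?_
    have hZε : (Z + ε • 1).PosDef := Matrix.PosDef.posSemidef_add hZ (Matrix.PosDef.one.smul hε)
    have h := hφ _ _ (hZε.smul hp) hZε
    rw [hprop _ _ hZε hp, ← rtrLinear_apply] at h
    simp only [map_add, map_smul, smul_eq_mul, rtrLinear_apply] at h
    linarith
  let g (r : ℝ) : Matrix n n ℂ →ₗ[ℝ] ℝ :=
    (r * Real.log r - r + 1) • rtrLinear n - r • φ₁ - φ₂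
  have hg_apply (r : ℝ) (Z : Matrix n n ℂ) :
      g r Z = (r * Real.log r - r + 1) * rtr Z - r * φ₁ Z - φ₂ Z := rfl
  have hg (r : ℝ) (hr : 0 < r) (Z : Matrix n n ℂ) (hZ : Z.PosSemidef) : 0 ≤ g r Z := by
    rw [hg_apply]
    linarith [hpsd Z hZ r hr]
  have hsum : g r₁ P + g r₂ (1 - P) = 0 := by
    rw [hbase, map_add, map_smul, map_smul] at hφA
    have h1 : φ₂ 1 = φ₂ P + φ₂ (1 - P) := by rw [← map_add, add_sub_cancel]
    simp only [smul_eq_mul] at hφA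
    rw [hg_apply, hg_apply]
    linarith
  have hg₁ : g r₁ P = 0 := by
    linarith [hg r₁ hr₁ P hPpsd, hg r₂ hr₂ _ hQpsd]
  have hg₂ : g r₂ (1 - P) = 0 := by linarith
  have hφZ (Z : Matrix n n ℂ) (hZ : Z.PosSemidef) :
      φ₁ Z = Real.log r₁ * rtr (P * Z) + Real.log r₂ * rtr ((1 - P) * Z) ∧
      φ₂ Z = (1 - r₁) * rtr (P * Z) + (1 - r₂) * rtr ((1 - P) * Z) := by
    obtain ⟨h1, h2⟩ := map_block_eq_zero (g r₁) (hg r₁ hr₁) hP hPP hg₁ hZ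
    obtain ⟨h3, h4⟩ := map_block_eq_zero (g r₂) (hg r₂ hr₂) hQ hQQ hg₂ hZ
    rw [sub_sub_cancel, add_comm] at h4
    have hP0 : P * (1 - P) = 0 := by simp [mul_sub, hPP]
    have hQ0 : (1 - P) * P = 0 := by simp [sub_mul, hPP]
    set O := P * Z * (1 - P) + (1 - P) * Z * P with hO
    have hOtr : rtr O = 0 := by
      rw [hO, ← rtrLinear_apply, map_add, rtrLinear_apply, rtrLinear_apply, rtr_mul_comm,
        ← mul_assoc, hQ0, rtr_mul_comm ((1 - P) * Z), ← mul_assoc, hP0]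
      simp [rtr]
    rw [hg_apply, hOtr] at h2 h4
    have hO1 : φ₁ O = 0 := by
      have : (r₁ - r₂) * φ₁ O = 0 := by linarith
      exact (mul_eq_zero.1 this).resolve_left (sub_ne_zero.2 hr)
    have hO2 : φ₂ O = 0 := by rw [hO1] at h2; linarith
    have e1 : rtr (P * Z * P) = rtr (P * Z) := by
      rw [rtr_mul_comm, ← mul_assoc, hPP]
    have e2 : rtr ((1 - P) * Z * (1 - P)) = rtr ((1 - P) * Z) := by
      rw [rtr_mul_comm, ← mul_assoc, hQQ]
    have hZ1 : (P * Z * P).PosSemidef := by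
      simpa [hP.eq] using hZ.mul_mul_conjTranspose_same P
    have hZ2 : ((1 - P) * Z * (1 - P)).PosSemidef := by
      have := hZ.mul_mul_conjTranspose_same (1 - P)
      rwa [hQ.eq] at this
    rw [hg_apply] at h1 h3
    obtain ⟨a1, a2⟩ := eq_log_mul_of_tangent hr₁ (hpsd _ hZ1) (by linarith)
    obtain ⟨b1, b2⟩ := eq_log_mul_of_tangent hr₂ (hpsd _ hZ2) (by linarith)
    have hdec : Z = P * Z * P + O + (1 - P) * Z * (1 - P) := by
      rw [hO]
      noncomm_ring
    constructor
    · conv_lhs => rw [hdec]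
      rw [map_add, map_add, hO1, a1, b1, e1, e2, add_zero]
    · conv_lhs => rw [hdec]
      rw [map_add, map_add, hO2, a2, b2, e1, e2, add_zero]
  have h := hφ X W hX hW
  rw [(hφZ X hX.posSemidef).1, (hφZ W hW.posSemidef).2] at h
  linarith

/-- The projection onto the positive part of a Hermitian matrix attains the trace norm. -/
theorem exists_positive_part_projection {n : Type*} [Fintype n] [DecidableEq n]
    {Δ : Matrix n n ℂ} (hΔ : Δ.IsHermitian) :
    ∃ P : Matrix n n ℂ, P.IsHermitian ∧ P * P = P ∧
      traceNorm Δ = 2 * rtr (P * Δ) - rtr Δ ∧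
      ∀ r₁ r₂ : ℝ, mlog (r₁ • P + r₂ • (1 - P)) = Real.log r₁ • P + Real.log r₂ • (1 - P) := by
  have hsa : IsSelfAdjoint Δ := hΔ
  have hcont (f : ℝ → ℝ) : ContinuousOn f (spectrum ℝ Δ) :=
    Δ.finite_real_spectrum.continuousOn f
  have hcont' (f g : ℝ → ℝ) : ContinuousOn g (f '' spectrum ℝ Δ) :=
    (Δ.finite_real_spectrum.image f).continuousOn g
  let i : ℝ → ℝ := fun t ↦ if 0 < t then 1 else 0
  have hcomb (r₁ r₂ : ℝ) : r₁ • cfc i Δ + r₂ • (1 - cfc i Δ) =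
      cfc (fun t ↦ if 0 < t then r₁ else r₂) Δ := by
    rw [← cfc_const_one ℝ Δ, ← cfc_sub _ _ Δ (hcont _) (hcont _), ← cfc_smul _ _ Δ (hcont _),
      ← cfc_smul _ _ Δ (hcont _), ← cfc_add _ _ _ (hcont _) (hcont _)]
    congr 1
    ext t
    by_cases ht : 0 < t <;> simp [i, ht]
  refine ⟨cfc i Δ, IsSelfAdjoint.cfc, ?_, ?_, fun r₁ r₂ ↦ ?_⟩
  · rw [← cfc_mul _ _ Δ (hcont _) (hcont _)]
    congr 1
    ext t
    by_cases ht : 0 < t <;> simp [i, ht]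
  · have h1 : Δᴴ * Δ = cfc (fun t : ℝ ↦ t * t) Δ := by
      rw [cfc_mul _ _ Δ (hcont _) (hcont _), cfc_id' ℝ Δ, hΔ.eq]
    have h2 : cfc i Δ * Δ = cfc (fun t ↦ i t * t) Δ := by
      rw [cfc_mul _ _ Δ (hcont _) (hcont _), cfc_id' ℝ Δ]
    have h3 : cfc (fun t : ℝ ↦ |t|) Δ = (2 : ℝ) • (cfc i Δ * Δ) - Δ := by
      rw [h2, ← cfc_smul _ _ Δ (hcont _)]
      conv_rhs => arg 2; rw [← cfc_id' ℝ Δ]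
      rw [← cfc_sub _ _ Δ (hcont _) (hcont _)]
      congr 1
      ext t
      by_cases ht : 0 < t
      · simp [i, ht, abs_of_pos ht]; ring
      · simp [i, ht, abs_of_nonpos (not_lt.1 ht)]
    rw [traceNorm, h1, ← cfc_comp' _ _ Δ (hcont' _ _) (hcont _)]
    simp only [Real.sqrt_mul_self_eq_abs]
    rw [h3, ← rtrLinear_apply, map_sub, map_smul, rtrLinear_apply, rtrLinear_apply, smul_eq_mul]
  · rw [hcomb, hcomb, mlog, ← cfc_comp' _ _ Δ (hcont' _ _) (hcont _)]
    congr 1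
    ext t
    split_ifs <;> rfl

theorem rtr_projection_mul_pos {n : Type*} [Fintype n] [DecidableEq n] [Nonempty n]
    {P Z : Matrix n n ℂ} (hP : P.IsHermitian) (hPP : P * P = P) (hP0 : P ≠ 0) (hZ : Z.PosDef) :
    0 < rtr (P * Z) := by
  obtain ⟨s, hs, hs'⟩ := hZ.exists_smul_add_posDef
    (isHermitian_one : (1 : Matrix n n ℂ).IsHermitian).neg
  have hpsd : P.PosSemidef := by
    simpa [hP.eq, hPP] using posSemidef_conjTranspose_mul_self P
  have htr : 0 < rtr P := by
    have h1 : P.trace ≠ 0 := by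
      have := (trace_conjTranspose_mul_self_eq_zero_iff (A := P)).not.2 hP0
      rwa [hP.eq, hPP] at this
    exact (Complex.lt_def.1 (hpsd.trace_nonneg.lt_of_ne' h1)).1
  have h := (Complex.le_def.1
    ((hs' s le_rfl).posSemidef.mul_mul_conjTranspose_same P).trace_nonneg).1
  rw [hP.eq] at h
  have e : P * (s • Z + -1) * P = s • (P * Z * P) - P := by
    simp [mul_add, add_mul, hPP, sub_eq_add_neg]
  have e1 : rtr (P * Z * P) = rtr (P * Z) := by
    rw [rtr_mul_comm, ← mul_assoc, hPP]
  rw [e] at h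
  change 0 ≤ rtr (s • (P * Z * P) - P) at h
  rw [← rtrLinear_apply, map_sub, map_smul, rtrLinear_apply, rtrLinear_apply, e1,
    smul_eq_mul] at h
  exact pos_of_mul_pos_right (by linarith) hs.le

section

open scoped MatrixOrder

theorem mlog_smul {n : Type*} [Fintype n] [DecidableEq n] {Z : Matrix n n ℂ} (hZ : Z.PosDef)
    {p : ℝ} (hp : 0 < p) : mlog (p • Z) = Real.log p • 1 + mlog Z := by
  have hsa : IsSelfAdjoint Z := hZ.1
  have hcont (f : ℝ → ℝ) : ContinuousOn f (spectrum ℝ Z) :=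
    Z.finite_real_spectrum.continuousOn f
  have hZ' : IsStrictlyPositive Z := isStrictlyPositive_iff_posDef.2 hZ
  rw [mlog, mlog, ← cfc_comp_smul p Real.log Z
    ((Z.finite_real_spectrum.image _).continuousOn _) hsa, ← cfc_const_one ℝ Z,
    ← cfc_smul _ _ Z (hcont _), ← cfc_add _ _ _ (hcont _) (hcont _)]
  refine cfc_congr fun t ht ↦ ?_
  simp [Real.log_mul hp.ne' (hZ'.spectrum_pos ht).ne']

end

theorem stmt12 {n : Type*} [Fintype n] [DecidableEq n]
    (R : Matrix n n ℂ → Matrix n n ℂ → EReal)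
    (hnonneg : ∀ X W : Matrix n n ℂ, X.PosDef → W.PosDef → 0 ≤ R X W)
    (hconv : ∀ (X₁ X₂ W₁ W₂ : Matrix n n ℂ), X₁.PosDef → X₂.PosDef → W₁.PosDef → W₂.PosDef →
      ∀ t : ℝ, t ∈ Set.Icc (0 : ℝ) 1 →
        R ((1 - t) • X₁ + t • X₂) ((1 - t) • W₁ + t • W₂) ≤
          ((1 - t : ℝ) : EReal) * R X₁ W₁ + (t : EReal) * R X₂ W₂)
    (hscale₁ : ∀ (X W : Matrix n n ℂ) (l : ℝ), 0 < l → X.PosDef → W.PosDef →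
      R (l • X) (l • W) = (l : EReal) * R X W)
    (hscale₂ : ∀ (X W : Matrix n n ℂ) (l : ℝ), 0 < l → X.PosDef → W.PosDef →
      R (l • X) W = (l : EReal) * R X W + ((l * Real.log l * rtr X + (1 - l) * rtr W : ℝ) : EReal))
    (hcomm : ∀ X W : Matrix n n ℂ, X.PosDef → W.PosDef → X * W = W * X →
      R X W = ((rtr (X * (mlog X - mlog W)) + rtr W - rtr X : ℝ) : EReal))
    (X W : Matrix n n ℂ) (hX : X.PosDef) (hW : W.PosDef) :
    (((1 / 2) * rtr X * traceNorm ((rtr X)⁻¹ • X - (rtr W)⁻¹ • W) ^ 2 : ℝ) : EReal) ≤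
      R X W := by
  set Δ : Matrix n n ℂ := (rtr X)⁻¹ • X - (rtr W)⁻¹ • W with hΔdef
  rcases eq_or_ne (traceNorm Δ) 0 with h0 | h0
  · rw [h0]
    simpa using hnonneg X W hX hW
  have : Nonempty n := by
    by_contra hn
    rw [not_nonempty_iff] at hn
    exact h0 (by simp [traceNorm, rtr, trace])
  have hfin (X W : Matrix n n ℂ) (hX : X.PosDef) (hW : W.PosDef) :
      ((R X W).toReal : EReal) = R X W := by
    refine EReal.coe_toReal (ne_of_lt ?_) (ne_of_gt (lt_of_lt_of_le (by simp) (hnonneg X W hX hW)))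
    have hone : (-(1 : Matrix n n ℂ)).IsHermitian := isHermitian_one.neg
    obtain ⟨s, hs, hs'⟩ := hX.exists_smul_add_posDef hone
    obtain ⟨t, ht, ht'⟩ := hW.exists_smul_add_posDef hone
    have hc : 0 < max s t := lt_max_of_lt_left hs
    have h1 := (hs' _ (le_max_left s t))
    have h2 := (ht' _ (le_max_right s t))
    have hX' := hcomm _ _ h1 .one (by simp)
    have hW' := hcomm _ _ .one h2 (by simp)
    have h := hconv _ _ _ _ h1 .one .one h2 (1 / 2) (by norm_num)
    have e1 (M : Matrix n n ℂ) : (1 - 1 / 2 : ℝ) • (max s t • M + -1) + (1 / 2 : ℝ) • (1 : Matrix n n ℂ) =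
        (max s t / 2) • M := by
      rw [smul_add, smul_smul, smul_neg]
      norm_num
      ring_nf
    have e2 (M : Matrix n n ℂ) : (1 - 1 / 2 : ℝ) • (1 : Matrix n n ℂ) + (1 / 2 : ℝ) • (max s t • M + -1) =
        (max s t / 2) • M := by
      rw [← e1 M, add_comm]
      norm_num
    rw [e1, e2, hX', hW', hscale₁ _ _ _ (by positivity) hX hW, ← EReal.coe_mul, ← EReal.coe_mul,
      ← EReal.coe_add] at h
    refine lt_top_iff_ne_top.2 fun htop ↦ ?_
    rw [htop, EReal.coe_mul_top_of_pos (by positivity)] at h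
    exact absurd h (not_le_of_gt (EReal.coe_lt_top _))
  let S (X W : Matrix n n ℂ) : ℝ := (R X W).toReal
  have hS (X W : Matrix n n ℂ) (hX : X.PosDef) (hW : W.PosDef) : R X W = (S X W : EReal) :=
    (hfin X W hX hW).symm
  have hsmul (X W : Matrix n n ℂ) (l : ℝ) (hl : 0 < l) (hX : X.PosDef) (hW : W.PosDef) :
      S (l • X) (l • W) = l * S X W := by
    have h := hscale₁ X W l hl hX hW
    rw [hS _ _ (hX.smul hl) (hW.smul hl), hS _ _ hX hW] at h
    exact_mod_cast h
  have hadd (X₁ X₂ W₁ W₂ : Matrix n n ℂ) (hX₁ : X₁.PosDef) (hX₂ : X₂.PosDef) (hW₁ : W₁.PosDef)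
      (hW₂ : W₂.PosDef) : S (X₁ + X₂) (W₁ + W₂) ≤ S X₁ W₁ + S X₂ W₂ := by
    have h := hconv X₁ X₂ W₁ W₂ hX₁ hX₂ hW₁ hW₂ (1 / 2) (by norm_num)
    have e (M N : Matrix n n ℂ) : (1 - 1 / 2 : ℝ) • M + (1 / 2 : ℝ) • N = (1 / 2 : ℝ) • (M + N) := by
      rw [smul_add]
      norm_num
    have hh : (0 : ℝ) < 1 / 2 := by norm_num
    rw [e, e, hscale₁ _ _ _ hh (hX₁.add hX₂) (hW₁.add hW₂),
      hS _ _ (hX₁.add hX₂) (hW₁.add hW₂), hS _ _ hX₁ hW₁, hS _ _ hX₂ hW₂] at h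
    have h' : 1 / 2 * S (X₁ + X₂) (W₁ + W₂) ≤ (1 - 1 / 2) * S X₁ W₁ + 1 / 2 * S X₂ W₂ := by
      exact_mod_cast h
    linarith
  have hScomm (X W : Matrix n n ℂ) (hX : X.PosDef) (hW : W.PosDef) (h : X * W = W * X) :
      S X W = rtr (X * (mlog X - mlog W)) + rtr W - rtr X := by
    have h := hcomm X W hX hW h
    rw [hS _ _ hX hW] at h
    exact_mod_cast h
  have hprop (Z : Matrix n n ℂ) (p : ℝ) (hZ : Z.PosDef) (hp : 0 < p) :
      S (p • Z) Z = (p * Real.log p - p + 1) * rtr Z := by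
    rw [hScomm _ _ (hZ.smul hp) hZ (by simp), mlog_smul hZ hp, add_sub_cancel_right]
    simp only [mul_smul_comm, mul_one, ← rtrLinear_apply, map_smul, smul_eq_mul]
    ring
  have hΔ : Δ.IsHermitian := by
    simp [hΔdef, IsHermitian, hX.1.eq, hW.1.eq]
  have hx : 0 < rtr X := (Complex.lt_def.1 hX.trace_pos).1
  have hw : 0 < rtr W := (Complex.lt_def.1 hW.trace_pos).1
  obtain ⟨P, hP, hPP, hnorm, hlog⟩ := exists_positive_part_projection hΔ
  have htrΔ : rtr Δ = 0 := by
    simp only [hΔdef, ← rtrLinear_apply, map_sub, map_smul, smul_eq_mul]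
    rw [rtrLinear_apply, rtrLinear_apply, inv_mul_cancel₀ hx.ne', inv_mul_cancel₀ hw.ne', sub_self]
  rw [htrΔ, sub_zero] at hnorm
  have hQ : (1 - P).IsHermitian := by simp [IsHermitian, hP.eq]
  have hQQ : (1 - P) * (1 - P) = 1 - P := by
    simp [mul_sub, sub_mul, hPP]
  have hP0 : P ≠ 0 := by
    rintro rfl
    exact h0 (by simp [hnorm, rtr])
  have hQ0 : 1 - P ≠ 0 := by
    intro h
    rw [← sub_eq_zero.1 h, one_mul, htrΔ, mul_zero] at hnorm
    exact h0 hnorm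
  have hx₁ := rtr_projection_mul_pos hP hPP hP0 hX
  have hx₂ := rtr_projection_mul_pos hQ hQQ hQ0 hX
  have hw₁ := rtr_projection_mul_pos hP hPP hP0 hW
  have hw₂ := rtr_projection_mul_pos hQ hQQ hQ0 hW
  have hsplit (Z : Matrix n n ℂ) : rtr (P * Z) + rtr ((1 - P) * Z) = rtr Z := by
    rw [← rtrLinear_apply, ← rtrLinear_apply, ← map_add, ← add_mul, add_sub_cancel, one_mul,
      rtrLinear_apply]
  have hPΔ : rtr (P * Δ) = rtr (P * X) / rtr X - rtr (P * W) / rtr W := by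
    simp only [hΔdef, mul_sub, mul_smul_comm, ← rtrLinear_apply, map_sub, map_smul, smul_eq_mul]
    ring
  have hr : rtr (P * X) / rtr (P * W) ≠ rtr ((1 - P) * X) / rtr ((1 - P) * W) := by
    intro h
    apply h0
    rw [hnorm, hPΔ, ← hsplit X, ← hsplit W]
    rw [div_eq_div_iff hw₁.ne' hw₂.ne'] at h
    rw [mul_eq_zero]
    right
    rw [sub_eq_zero, div_eq_div_iff (by positivity) (by positivity)]
    linarith
  set r₁ := rtr (P * X) / rtr (P * W) with hr₁
  set r₂ := rtr ((1 - P) * X) / rtr ((1 - P) * W) with hr₂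
  have hr₁0 : 0 < r₁ := div_pos hx₁ hw₁
  have hr₂0 : 0 < r₂ := div_pos hx₂ hw₂
  have hA := posDef_smul_projection_add hP hPP hr₁0 hr₂0
  have hbase : S (r₁ • P + r₂ • (1 - P)) 1 = (r₁ * Real.log r₁ - r₁ + 1) * rtr P +
      (r₂ * Real.log r₂ - r₂ + 1) * rtr (1 - P) := by
    have hlog1 : mlog (1 : Matrix n n ℂ) = 0 := by
      have := hlog 1 1
      simpa using this
    have hmul : (r₁ • P + r₂ • (1 - P)) * (Real.log r₁ • P + Real.log r₂ • (1 - P)) =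
        (r₁ * Real.log r₁) • P + (r₂ * Real.log r₂) • (1 - P) := by
      have hPQ : P * (1 - P) = 0 := by simp [mul_sub, hPP]
      have hQP : (1 - P) * P = 0 := by simp [sub_mul, hPP]
      simp only [add_mul, mul_add, smul_mul_assoc, mul_smul_comm, hPP, hQQ, hPQ, hQP, smul_zero,
        add_zero, zero_add, smul_smul, mul_comm]
    have h1 := hsplit 1
    rw [mul_one, mul_one] at h1
    rw [hScomm _ _ hA .one (by simp), hlog, hlog1, sub_zero, hmul, ← h1]
    simp only [← rtrLinear_apply, map_add, map_smul, smul_eq_mul]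
    ring
  have hmain := binary_measurement_le S hadd hsmul hprop hP hPP hr₁0 hr₂0 hr hbase hX hW
  have hpin := binary_pinsker_unnormalized hx₁ hx₂ hw₁ hw₂
  rw [hsplit, hsplit, ← hr₁, ← hr₂] at hpin
  have e₁ : r₁ * rtr (P * W) = rtr (P * X) := div_mul_cancel₀ _ hw₁.ne'
  have e₂ : r₂ * rtr ((1 - P) * W) = rtr ((1 - P) * X) := div_mul_cancel₀ _ hw₂.ne'
  rw [hS _ _ hX hW, EReal.coe_le_coe_iff, hnorm, hPΔ]
  linarith [hsplit X, hsplit W]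
end

section
/- For all Hermitian n×n matrices H and L: Tr[e^H e^L] − Tr[e^{H+L}] ≤ Tr[e^H H e^L] − Tr[e^H e^{L/2} H e^{L/2}]. -/
open Matrix ComplexOrder

noncomputable def mexp {n : Type*} [Fintype n] [DecidableEq n] (A : Matrix n n ℂ) :
    Matrix n n ℂ :=
  cfc Real.exp A

section TraceInequalities

open NormedSpace Filter Topology
open scoped Matrix.Norms.L2Operator

variable {n : Type*} [Fintype n]

lemma norm_trace_mul_le (G K : Matrix n n ℂ) {T : ℝ} (hG : (G * Gᴴ).trace.re ≤ T)
    (hK : (Kᴴ * K).trace.re ≤ T) : ‖(G * K).trace‖ ≤ T := by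
  have hG' : ∑ i, ∑ j, ‖G i j‖ ^ 2 = (G * Gᴴ).trace.re := by
    simp [trace, mul_apply, Complex.mul_conj, Complex.normSq_eq_norm_sq, -Complex.ofReal_pow]
  have hK' : ∑ i, ∑ j, ‖K j i‖ ^ 2 = (Kᴴ * K).trace.re := by
    simp [trace, mul_apply, mul_comm, Complex.mul_conj, Complex.normSq_eq_norm_sq, -Complex.ofReal_pow]
  calc ‖(G * K).trace‖ ≤ ∑ i, ∑ j, ‖G i j‖ * ‖K j i‖ := by
        simp only [trace, diag_apply, mul_apply]
        refine (norm_sum_le _ _).trans (Finset.sum_le_sum fun i _ => ?_)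
        refine (norm_sum_le _ _).trans (Finset.sum_le_sum fun j _ => (norm_mul_le _ _))
    _ ≤ ∑ i, ∑ j, (‖G i j‖ ^ 2 / 2 + ‖K j i‖ ^ 2 / 2) := by
        refine Finset.sum_le_sum fun i _ => Finset.sum_le_sum fun j _ => ?_
        linarith [two_mul_le_add_sq ‖G i j‖ ‖K j i‖]
    _ = (G * Gᴴ).trace.re / 2 + (Kᴴ * K).trace.re / 2 := by
        rw [← hG', ← hK']
        rw [Finset.sum_comm (f := fun i j => ‖K j i‖ ^ 2)]
        simp only [Finset.sum_add_distrib, Finset.sum_div]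
        congr 1
        rw [Finset.sum_comm]
    _ ≤ T := by linarith

variable [DecidableEq n]

/-- The entire function `z ↦ exp (z • A)`. -/
noncomputable def cexpm (A : Matrix n n ℂ) (z : ℂ) : Matrix n n ℂ := exp (z • A)

lemma cexpm_zero (A : Matrix n n ℂ) : cexpm A 0 = 1 := by
  simp [cexpm]

lemma cexpm_add (A : Matrix n n ℂ) (z w : ℂ) :
    cexpm A (z + w) = cexpm A z * cexpm A w := by
  rw [cexpm, add_smul, Matrix.exp_add_of_commute _ _
    (((Commute.refl A).smul_left z).smul_right w)]
  rfl

lemma conjTranspose_cexpm {A : Matrix n n ℂ} (hA : A.IsHermitian) (z : ℂ) :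
    (cexpm A z)ᴴ = cexpm A (star z) := by
  rw [cexpm, ← Matrix.exp_conjTranspose, conjTranspose_smul, hA.eq]
  rfl

lemma isHermitian_cexpm_ofReal {A : Matrix n n ℂ} (hA : A.IsHermitian) (x : ℝ) :
    (cexpm A x).IsHermitian := by
  rw [IsHermitian, conjTranspose_cexpm hA]
  simp

lemma hasDerivAt_cexpm (A : Matrix n n ℂ) (z : ℂ) :
    HasDerivAt (cexpm A) (cexpm A z * A) z :=
  hasDerivAt_exp_smul_const A z

lemma cexpm_mem_unitary {A : Matrix n n ℂ} (hA : A.IsHermitian) {z : ℂ} (hz : z.re = 0) :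
    cexpm A z ∈ unitary (Matrix n n ℂ) := by
  have hs : star z = -z := by
    apply Complex.ext <;> simp [hz]
  rw [Unitary.mem_iff, star_eq_conjTranspose, conjTranspose_cexpm hA, hs, ← cexpm_add,
    ← cexpm_add]
  simp [cexpm_zero]

lemma exists_norm_cexpm_le {A : Matrix n n ℂ} (hA : A.IsHermitian) (r : ℝ) :
    ∃ C, 0 ≤ C ∧ ∀ z : ℂ, |z.re| ≤ r → ‖cexpm A z‖ ≤ C := by
  have hc : Continuous (fun x : ℝ => cexpm A x) :=
    (continuous_iff_continuousAt.2 fun z => (hasDerivAt_cexpm A z).continuousAt).comp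
      Complex.continuous_ofReal
  obtain ⟨C, hC⟩ := (isCompact_Icc (a := -r) (b := r)).exists_bound_of_continuousOn hc.continuousOn
  refine ⟨max C 0, le_max_right _ _, fun z hz => le_max_of_le_left ?_⟩
  have hu := cexpm_mem_unitary hA (z := z.im * Complex.I) (by simp)
  rw [← Complex.re_add_im z, cexpm_add, CStarRing.norm_mul_mem_unitary _ hu]
  exact hC _ (abs_le.1 hz)

lemma exp_hermitian_eq {A : Matrix n n ℂ} (hA : A.IsHermitian) : cfc Real.exp A = exp A :=
  CFC.real_exp_eq_normedSpace_exp hA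

lemma cfc_exp_half_eq {A : Matrix n n ℂ} (hA : A.IsHermitian) :
    cfc (fun x : ℝ => Real.exp (x / 2)) A = cexpm A (1 / 2) := by
  have hA' : IsSelfAdjoint A := hA
  have h : cfc (fun x : ℝ => x / 2) A = (1 / 2 : ℂ) • A := by
    have : (fun x : ℝ => x / 2) = fun x : ℝ => (1 / 2 : ℝ) • x := by
      ext x; simp; ring
    rw [this, cfc_smul_id _ A hA']
    ext i j
    simp
  have hs : ((1 / 2 : ℂ) • A).IsHermitian := by
    rw [← h]; exact cfc_predicate _ _
  rw [cfc_comp' Real.exp (fun x : ℝ => x / 2) A, h, exp_hermitian_eq hs]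
  rfl

/-- The derivative at `p = 1` of the Araki-Lieb-Thirring inequality
`Tr (Y ^ (1/2) * X * Y ^ (1/2)) ^ p ≤ Tr (X ^ p * Y ^ p)` for `X = exp H` and `Y = exp L`. -/
lemma trace_exp_mul_le {H L S : Matrix n n ℂ} (hH : H.IsHermitian) (hL : L.IsHermitian)
    (hS : S.IsHermitian) (h : exp S = cexpm L (1 / 2) * exp H * cexpm L (1 / 2)) :
    (exp S * S).trace.re ≤ (exp H * H * exp L).trace.re + (exp S * L).trace.re := by
  have e1 (A : Matrix n n ℂ) : exp A = cexpm A 1 := by simp [cexpm]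
  have half (A : Matrix n n ℂ) : cexpm A (1 / 2) * cexpm A (1 / 2) = exp A := by
    rw [← cexpm_add, e1]; norm_num
  have sh {A : Matrix n n ℂ} (hA : A.IsHermitian) : (cexpm A (1 / 2))ᴴ = cexpm A (1 / 2) := by
    simpa using (isHermitian_cexpm_ofReal hA (1 / 2)).eq
  have uu {A : Matrix n n ℂ} (hA : A.IsHermitian) {z : ℂ} (hz : z.re = 0) :
      cexpm A z * (cexpm A z)ᴴ = 1 := (Unitary.mem_iff.1 (cexpm_mem_unitary hA hz)).2
  set T : ℝ := (exp S).trace.re with hT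
  set tr := LinearMap.toContinuousLinearMap (Matrix.traceLinearMap n ℂ ℂ) with htr
  have tr_apply (M : Matrix n n ℂ) : tr M = M.trace := rfl
  set M : ℂ → Matrix n n ℂ := fun z =>
    cexpm H (z + 1 / 2) * cexpm L z * cexpm S (1 / 2 - z) * cexpm L (1 / 2) with hM
  have dM (z : ℂ) : HasDerivAt M
      ((((cexpm H (z + 1 / 2) * H) * cexpm L z + cexpm H (z + 1 / 2) * (cexpm L z * L)) *
        cexpm S (1 / 2 - z) + cexpm H (z + 1 / 2) * cexpm L z *
          (-(cexpm S (1 / 2 - z) * S))) * cexpm L (1 / 2)) z := by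
    have d1 : HasDerivAt (fun z => cexpm H (z + 1 / 2)) (cexpm H (z + 1 / 2) * H) z :=
      (hasDerivAt_cexpm H (z + 1 / 2)).comp_add_const z (1 / 2)
    have d3 : HasDerivAt (fun z => cexpm S (1 / 2 - z)) (-(cexpm S (1 / 2 - z) * S)) z :=
      (hasDerivAt_cexpm S (1 / 2 - z)).comp_const_sub (1 / 2) z
    exact ((d1.mul (hasDerivAt_cexpm L z)).mul d3).mul_const _
  have dF (z : ℂ) := tr.hasFDerivAt.comp_hasDerivAt z (dM z)
  set F : ℂ → ℂ := tr ∘ M with hF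
  have hTHL : (cexpm H (1 / 2) * exp L * cexpm H (1 / 2)).trace.re = T := by
    rw [hT, h, Matrix.mul_assoc, trace_mul_comm, trace_mul_comm (cexpm L (1 / 2) * exp H),
      ← Matrix.mul_assoc, Matrix.mul_assoc, half, half]
  have bl : ∀ z : ℂ, z.re = 0 → ‖F z‖ ≤ T := by
    intro z hz
    have hz' : (-z).re = 0 := by simp [hz]
    have : F z = ((cexpm H z * cexpm L z * cexpm S (-z) * cexpm S (1 / 2)) *
        (cexpm L (1 / 2) * cexpm H (1 / 2))).trace := by
      rw [hF, Function.comp_apply, tr_apply, hM]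
      simp only [add_comm z (1 / 2), cexpm_add, show (1 / 2 : ℂ) - z = -z + 1 / 2 by ring]
      simp only [Matrix.mul_assoc]
      rw [trace_mul_comm]
      simp only [Matrix.mul_assoc]
    rw [this]
    apply norm_trace_mul_le
    · have : (cexpm H z * cexpm L z * cexpm S (-z) * cexpm S (1 / 2)) *
          (cexpm H z * cexpm L z * cexpm S (-z) * cexpm S (1 / 2))ᴴ =
          (cexpm H z * cexpm L z * cexpm S (-z)) * (exp S *
            (cexpm H z * cexpm L z * cexpm S (-z))ᴴ) := by
        rw [conjTranspose_mul _ (cexpm S (1 / 2)), sh hS, ← half S]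
        simp only [Matrix.mul_assoc]
      have hu : cexpm H z * cexpm L z * cexpm S (-z) ∈ unitary (Matrix n n ℂ) :=
        mul_mem (mul_mem (cexpm_mem_unitary hH hz) (cexpm_mem_unitary hL hz))
          (cexpm_mem_unitary hS hz')
      have hu' := (Unitary.mem_iff.1 hu).1
      rw [star_eq_conjTranspose] at hu'
      rw [this, trace_mul_comm, Matrix.mul_assoc, hu', Matrix.mul_one]
    · rw [conjTranspose_mul, sh hL, sh hH, ← hTHL, ← half L]
      simp only [Matrix.mul_assoc, le_refl]
  have br : ∀ z : ℂ, z.re = 1 / 2 → ‖F z‖ ≤ T := by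
    intro z hz
    obtain ⟨w, rfl⟩ : ∃ w, z = w + 1 / 2 := ⟨z - 1 / 2, by ring⟩
    have hw : w.re = 0 := by simpa using hz
    have hw' : (-w).re = 0 := by simp [hw]
    have : F (w + 1 / 2) = ((cexpm H (1 / 2) * cexpm L (1 / 2) * (cexpm L w * cexpm S (-w))) *
        (cexpm L (1 / 2) * cexpm H (1 / 2) * cexpm H w)).trace := by
      rw [hF, Function.comp_apply, tr_apply, hM]
      simp only [show (1 / 2 : ℂ) - (w + 1 / 2) = -w by ring,
        show w + 1 / 2 + 1 / 2 = 1 / 2 + w + 1 / 2 by ring]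
      rw [cexpm_add H, cexpm_add H, add_comm w, cexpm_add L]
      rw [trace_mul_comm, trace_mul_comm _ (cexpm L (1 / 2) * cexpm H (1 / 2) * cexpm H w)]
      simp only [Matrix.mul_assoc]
    rw [this]
    apply norm_trace_mul_le
    · have hu : cexpm L w * cexpm S (-w) ∈ unitary (Matrix n n ℂ) :=
        mul_mem (cexpm_mem_unitary hL hw) (cexpm_mem_unitary hS hw')
      have hu' := (Unitary.mem_iff.1 hu).2
      rw [star_eq_conjTranspose] at hu'
      rw [conjTranspose_mul _ (cexpm L w * cexpm S (-w)), Matrix.mul_assoc,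
        ← Matrix.mul_assoc (cexpm L w * cexpm S (-w)), hu', Matrix.one_mul, conjTranspose_mul,
        sh hL, sh hH, ← hTHL, ← half L]
      simp only [Matrix.mul_assoc, le_refl]
    · rw [conjTranspose_mul _ (cexpm H w), trace_mul_comm, ← Matrix.mul_assoc,
        Matrix.mul_assoc _ (cexpm H w), uu hH hw, Matrix.mul_one, conjTranspose_mul,
        sh hL, sh hH, trace_mul_comm, ← hTHL, ← half L]
      simp only [Matrix.mul_assoc, le_refl]
  have hbdd : BddAbove ((norm ∘ F) '' Complex.HadamardThreeLines.verticalClosedStrip 0 (1 / 2)) := by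
    obtain ⟨a, ha0, ha⟩ := exists_norm_cexpm_le hH 1
    obtain ⟨b, hb0, hb⟩ := exists_norm_cexpm_le hL 1
    obtain ⟨c, hc0, hc⟩ := exists_norm_cexpm_le hS 1
    refine ⟨‖tr‖ * (a * b * c * b), ?_⟩
    rintro _ ⟨z, hz, rfl⟩
    simp only [Complex.HadamardThreeLines.verticalClosedStrip, Set.mem_preimage, Set.mem_Icc] at hz
    refine (tr.le_opNorm _).trans (mul_le_mul_of_nonneg_left ?_ (norm_nonneg _))
    refine (norm_mul_le _ _).trans (mul_le_mul ?_ (hb _ ?_) (norm_nonneg _) (by positivity))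
    · refine (norm_mul_le _ _).trans (mul_le_mul ?_ (hc _ ?_) (norm_nonneg _) (by positivity))
      · refine (norm_mul_le _ _).trans (mul_le_mul (ha _ ?_) (hb _ ?_) (norm_nonneg _) ha0)
        · rw [abs_le]; simp; constructor <;> linarith
        · rw [abs_le]; constructor <;> linarith
      · rw [abs_le]; simp; constructor <;> linarith
    · rw [abs_le]; simp; constructor <;> linarith
  have dFd : Differentiable ℂ F := fun z => (dF z).differentiableAt
  have key : ∀ x ∈ Set.Icc (0 : ℝ) (1 / 2), (F x).re ≤ T := by
    intro x hx
    have h3 := Complex.HadamardThreeLines.norm_le_interp_of_mem_verticalClosedStrip'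
      (f := F) (z := (x : ℂ)) (a := T) (b := T) (l := 0) (u := 1 / 2) (by norm_num)
      (by simpa [Complex.HadamardThreeLines.verticalClosedStrip] using hx)
      dFd.diffContOnCl hbdd (fun z hz => bl z hz) (fun z hz => br z hz)
    have hT0 : 0 ≤ T := (norm_nonneg _).trans (bl 0 rfl)
    refine (Complex.re_le_norm _).trans (h3.trans (le_of_eq ?_))
    rw [← Real.rpow_add_of_nonneg hT0]
    · simp
    · simp only [Complex.ofReal_re]
      have := hx.2
      norm_num
      linarith
    · simp only [Complex.ofReal_re]
      have := hx.1
      positivity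
  have hend : (F ((1 / 2 : ℝ) : ℂ)).re = T := by
    rw [hF, Function.comp_apply, tr_apply, hM, hT, h]
    have e : ((1 / 2 : ℝ) : ℂ) = 1 / 2 := by simp
    simp only [e, sub_self, cexpm_zero, Matrix.mul_one, e1 H, add_halves]
    rw [trace_mul_comm, ← Matrix.mul_assoc]
  have hderiv := (dF ((1 / 2 : ℝ) : ℂ)).real_of_complex
  have hnonneg := by
    refine ge_of_tendsto (b := 0) (hasDerivAt_iff_tendsto_slope.1 hderiv |>.mono_left
      (nhdsWithin_mono (s := Set.Iio (1 / 2)) _ fun y hy => ne_of_lt hy)) ?_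
    filter_upwards [Ioo_mem_nhdsLT (show (0 : ℝ) < 1 / 2 by norm_num)] with x hx
    rw [slope_def_field, hend]
    exact div_nonneg_of_nonpos (by linarith [key x ⟨hx.1.le, hx.2.le⟩]) (by linarith [hx.2])
  rw [tr_apply] at hnonneg
  have e : ((1 / 2 : ℝ) : ℂ) = 1 / 2 := by simp
  simp only [e, sub_self, cexpm_zero, Matrix.mul_one, add_halves, Matrix.one_mul, ← e1,
    Matrix.add_mul, trace_add, Complex.add_re, Matrix.mul_neg, Matrix.neg_mul, trace_neg,
    Complex.neg_re] at hnonneg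
  have t1 : (exp S * S).trace = (exp H * cexpm L (1 / 2) * S * cexpm L (1 / 2)).trace := by
    rw [h, trace_mul_comm (exp H * cexpm L (1 / 2) * S)]
    simp only [Matrix.mul_assoc]
  have t2 : (exp S * L).trace = (exp H * (cexpm L (1 / 2) * L) * cexpm L (1 / 2)).trace := by
    rw [h, ← Matrix.mul_assoc (exp H), trace_mul_comm (exp H * cexpm L (1 / 2) * L)]
    simp only [Matrix.mul_assoc]
  rw [t1, t2]
  rw [Matrix.mul_assoc (exp H * H), half] at hnonneg
  linarith

lemma exp_eq_conj_diagonal {A : Matrix n n ℂ} (hA : A.IsHermitian) :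
    exp A = (hA.eigenvectorUnitary : Matrix n n ℂ) *
      diagonal (fun i => (Real.exp (hA.eigenvalues i) : ℂ)) *
        (hA.eigenvectorUnitary : Matrix n n ℂ)ᴴ := by
  rw [← exp_hermitian_eq hA, hA.cfc_eq]
  rfl

lemma eq_conj_diagonal {A : Matrix n n ℂ} (hA : A.IsHermitian) :
    A = (hA.eigenvectorUnitary : Matrix n n ℂ) *
      diagonal (fun i => (hA.eigenvalues i : ℂ)) *
        (hA.eigenvectorUnitary : Matrix n n ℂ)ᴴ :=
  hA.spectral_theorem

lemma trace_conj_diagonal_mul (U W : Matrix n n ℂ) (d e : n → ℝ) :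
    ((U * diagonal (fun i => (d i : ℂ)) * Uᴴ) * (W * diagonal (fun i => (e i : ℂ)) * Wᴴ)).trace.re =
      ∑ i, ∑ j, ‖(Uᴴ * W) i j‖ ^ 2 * (d i * e j) := by
  have : ((U * diagonal (fun i => (d i : ℂ)) * Uᴴ) *
      (W * diagonal (fun i => (e i : ℂ)) * Wᴴ)).trace =
      ((diagonal (fun i => (d i : ℂ)) * (Uᴴ * W)) *
        (diagonal (fun i => (e i : ℂ)) * (Uᴴ * W)ᴴ)).trace := by
    rw [conjTranspose_mul, conjTranspose_conjTranspose, Matrix.mul_assoc U, Matrix.mul_assoc U,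
      trace_mul_comm U]
    simp only [Matrix.mul_assoc]
  rw [this]
  simp only [trace, diag_apply, mul_apply (M := diagonal _ * _), diagonal_mul, Complex.re_sum,
    conjTranspose_apply]
  refine Finset.sum_congr rfl fun i _ => Finset.sum_congr rfl fun j _ => ?_
  rw [show (d i : ℂ) * (Uᴴ * W) i j * ((e j : ℂ) * star ((Uᴴ * W) i j)) =
    (d i * e j : ℂ) * ((Uᴴ * W) i j * star ((Uᴴ * W) i j)) by ring]
  rw [Complex.star_def, Complex.mul_conj, Complex.normSq_eq_norm_sq, ← Complex.ofReal_mul,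
    ← Complex.ofReal_mul, Complex.ofReal_re, mul_comm]

/-- **Klein's inequality** for the exponential function. -/
lemma trace_exp_sub_le {S K : Matrix n n ℂ} (hS : S.IsHermitian) (hK : K.IsHermitian) :
    (exp S).trace.re - (exp K).trace.re ≤ (exp S * S).trace.re - (exp S * K).trace.re := by
  set U := (hS.eigenvectorUnitary : Matrix n n ℂ) with hU
  set W := (hK.eigenvectorUnitary : Matrix n n ℂ) with hW
  set s := hS.eigenvalues
  set k := hK.eigenvalues
  have uU : U * Uᴴ = 1 := (Unitary.mem_iff.1 hS.eigenvectorUnitary.2).2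
  have uU' : Uᴴ * U = 1 := (Unitary.mem_iff.1 hS.eigenvectorUnitary.2).1
  have uW : W * Wᴴ = 1 := (Unitary.mem_iff.1 hK.eigenvectorUnitary.2).2
  have one_eq (V : Matrix n n ℂ) (hV : V * Vᴴ = 1) :
      V * diagonal (fun _ => ((1 : ℝ) : ℂ)) * Vᴴ = 1 := by
    simp [hV]
  have eS : exp S = U * diagonal (fun i => (Real.exp (s i) : ℂ)) * Uᴴ := exp_eq_conj_diagonal hS
  have eK : exp K = W * diagonal (fun i => (Real.exp (k i) : ℂ)) * Wᴴ := exp_eq_conj_diagonal hK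
  have eSS : exp S * S = U * diagonal (fun i => ((Real.exp (s i) * s i : ℝ) : ℂ)) * Uᴴ := by
    conv_lhs => rw [eS]; arg 2; rw [eq_conj_diagonal hS]
    rw [← hU, Matrix.mul_assoc, ← Matrix.mul_assoc Uᴴ, ← Matrix.mul_assoc Uᴴ, uU', Matrix.one_mul,
      ← Matrix.mul_assoc, Matrix.mul_assoc U, diagonal_mul_diagonal]
    simp only [Complex.ofReal_mul]
    rfl
  have t1 : (exp S).trace.re = ∑ i, ∑ j, ‖(Uᴴ * W) i j‖ ^ 2 * (Real.exp (s i) * 1) := by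
    rw [← trace_conj_diagonal_mul U W _ (fun _ => 1), one_eq W uW, Matrix.mul_one, eS]
  have t2 : (exp K).trace.re = ∑ i, ∑ j, ‖(Uᴴ * W) i j‖ ^ 2 * (1 * Real.exp (k j)) := by
    rw [← trace_conj_diagonal_mul U W (fun _ => 1), one_eq U uU, Matrix.one_mul, eK]
  have t3 : (exp S * S).trace.re =
      ∑ i, ∑ j, ‖(Uᴴ * W) i j‖ ^ 2 * (Real.exp (s i) * s i * 1) := by
    rw [← trace_conj_diagonal_mul U W _ (fun _ => 1), one_eq W uW, Matrix.mul_one, eSS]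
  have t4 : (exp S * K).trace.re =
      ∑ i, ∑ j, ‖(Uᴴ * W) i j‖ ^ 2 * (Real.exp (s i) * k j) := by
    rw [← trace_conj_diagonal_mul U W, ← eS, hW, ← eq_conj_diagonal hK]
  rw [t1, t2, t3, t4]
  simp only [← Finset.sum_sub_distrib, ← mul_sub]
  refine Finset.sum_le_sum fun i _ => Finset.sum_le_sum fun j _ =>
    mul_le_mul_of_nonneg_left ?_ (by positivity)
  have h1 := Real.add_one_le_exp (k j - s i)
  have h2 : Real.exp (k j) = Real.exp (s i) * Real.exp (k j - s i) := by
    rw [← Real.exp_add]; congr 1; ring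
  rw [h2]
  nlinarith [Real.exp_pos (s i)]

open scoped MatrixOrder in
lemma exists_isHermitian_exp_eq {A : Matrix n n ℂ} (hA : A.PosDef) :
    ∃ S : Matrix n n ℂ, S.IsHermitian ∧ exp S = A :=
  ⟨CFC.log A, IsSelfAdjoint.log, CFC.exp_log A hA.isStrictlyPositive⟩

lemma posDef_exp {A : Matrix n n ℂ} (hA : A.IsHermitian) : (exp A).PosDef := by
  have hh := (isHermitian_cexpm_ofReal hA (1 / 2)).eq
  have hi : cexpm A ((1 / 2 : ℝ) : ℂ) * cexpm A (-((1 / 2 : ℝ) : ℂ)) = 1 := by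
    rw [← cexpm_add]; simp [cexpm_zero]
  have : exp A = (cexpm A ((1 / 2 : ℝ) : ℂ))ᴴ * 1 * cexpm A ((1 / 2 : ℝ) : ℂ) := by
    rw [hh, Matrix.mul_one, ← cexpm_add, cexpm]
    norm_num
  rw [this]
  exact (PosDef.one).conjTranspose_mul_mul_same
    (mulVec_injective_of_isUnit (IsUnit.of_mul_eq_one _ hi))

end TraceInequalities

theorem stmt14 {n : Type*} [Fintype n] [DecidableEq n]
    (H L : Matrix n n ℂ) (hH : H.IsHermitian) (hL : L.IsHermitian) :
    rtr (mexp H * mexp L) - rtr (mexp (H + L)) ≤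
      rtr (mexp H * H * mexp L) -
        rtr (mexp H * (cfc (fun x : ℝ => Real.exp (x / 2)) L * H *
          cfc (fun x : ℝ => Real.exp (x / 2)) L)) := by
  rw [show mexp H = NormedSpace.exp H from exp_hermitian_eq hH,
    show mexp L = NormedSpace.exp L from exp_hermitian_eq hL,
    show mexp (H + L) = NormedSpace.exp (H + L) from exp_hermitian_eq (hH.add hL),
    cfc_exp_half_eq hL]
  have sL : (cexpm L (1 / 2))ᴴ = cexpm L (1 / 2) := by
    simpa using (isHermitian_cexpm_ofReal hL (1 / 2)).eq
  have hi : cexpm L (1 / 2) * cexpm L (-(1 / 2)) = 1 := by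
    rw [← cexpm_add]; simp [cexpm_zero]
  obtain ⟨S, hS, hSe⟩ := exists_isHermitian_exp_eq
    ((posDef_exp hH).conjTranspose_mul_mul_same
      (mulVec_injective_of_isUnit (IsUnit.of_mul_eq_one _ hi)))
  rw [sL] at hSe
  have h1 := trace_exp_mul_le hH hL hS hSe
  have h2 := trace_exp_sub_le hS (hH.add hL)
  have hLL : cexpm L (1 / 2) * cexpm L (1 / 2) = NormedSpace.exp L := by
    rw [← cexpm_add, cexpm]; norm_num
  have t1 : (NormedSpace.exp S).trace = (NormedSpace.exp H * NormedSpace.exp L).trace := by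
    rw [hSe, trace_mul_comm, ← Matrix.mul_assoc, hLL, trace_mul_comm]
  have t2 : (NormedSpace.exp S * H).trace =
      (NormedSpace.exp H * (cexpm L (1 / 2) * H * cexpm L (1 / 2))).trace := by
    rw [hSe, Matrix.mul_assoc, Matrix.mul_assoc, trace_mul_comm]
    simp only [Matrix.mul_assoc]
  rw [Matrix.mul_add, trace_add, Complex.add_re] at h2
  rw [t1, t2] at h2
  unfold rtr
  linarith
end
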